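/- arXiv:2310.03939 — 2 statements merged into one kernel-verified Lean document; each statement's English description precedes it below -/
import Mathlib

section
/- Fix ε ∈ (−1/6, 1/6). On the open simplex T₄ = {(z₁,z₂,z₃,z₄) ∈ (0,∞)⁴ : z₁+z₂+z₃+z₄ < 1}, with z₅ := 1−z₁−z₂−z₃−z₄, U := (z₁+z₂)(z₃+z₄) + z₅(z₁+z₂+z₃+z₄) > 0 and C := z₁z₂z₃ + z₁z₂z₄ + z₁z₃z₄ + z₂z₃z₄ + z₁z₂z₅ + z₂z₃z₅ + z₃z₄z₅ + z₁z₄z₅ > 0, all the integrands below are Lebesgue integrable on T₄ and ∫_{T₄} U^{3ε−1} C^{−(1+2ε)} − 4(1−3ε)·∫_{T₄} z₃z₅ U^{3ε−2} C^{−(1+2ε)} = (1+2ε)·[ 2·∫_{T₄} z₃z₄z₅ U^{3ε−1} C^{−(2+2ε)} + 2·∫_{T₄} z₂z₃z₅ U^{3ε−1} C^{−(2+2ε)} ]. -/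
open MeasureTheory

noncomputable section

/-- The open simplex `T₄ = {(z₁,z₂,z₃,z₄) ∈ (0,∞)⁴ : z₁+z₂+z₃+z₄ < 1}`. -/
def fiveT4 : Set (ℝ × ℝ × ℝ × ℝ) :=
  {z | 0 < z.1 ∧ 0 < z.2.1 ∧ 0 < z.2.2.1 ∧ 0 < z.2.2.2 ∧
    z.1 + z.2.1 + z.2.2.1 + z.2.2.2 < 1}

/-- The fifth Feynman parameter `z₅ = 1 − z₁ − z₂ − z₃ − z₄`. -/
def fiveZ5 (z : ℝ × ℝ × ℝ × ℝ) : ℝ := 1 - z.1 - z.2.1 - z.2.2.1 - z.2.2.2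

/-- The first Symanzik polynomial `U = (z₁+z₂)(z₃+z₄) + z₅(z₁+z₂+z₃+z₄)` of the
two-loop five-edge two-point graph. -/
def fiveU (z : ℝ × ℝ × ℝ × ℝ) : ℝ :=
  (z.1 + z.2.1) * (z.2.2.1 + z.2.2.2) + fiveZ5 z * (z.1 + z.2.1 + z.2.2.1 + z.2.2.2)

/-- The (normalised) second Symanzik polynomial
`C = z₁z₂z₃ + z₁z₂z₄ + z₁z₃z₄ + z₂z₃z₄ + z₁z₂z₅ + z₂z₃z₅ + z₃z₄z₅ + z₁z₄z₅` of the
two-loop five-edge two-point graph. -/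
def fiveC (z : ℝ × ℝ × ℝ × ℝ) : ℝ :=
  z.1 * z.2.1 * z.2.2.1 + z.1 * z.2.1 * z.2.2.2 + z.1 * z.2.2.1 * z.2.2.2 +
    z.2.1 * z.2.2.1 * z.2.2.2 + z.1 * z.2.1 * fiveZ5 z + z.2.1 * z.2.2.1 * fiveZ5 z +
    z.2.2.1 * z.2.2.2 * fiveZ5 z + z.1 * z.2.2.2 * fiveZ5 z

end

lemma five_bound_spoke {a b c d e ε : ℝ} (hε : ε ∈ Set.Ioo (-(1 : ℝ) / 6) (1 / 6))
    (ha : 1 / 5 ≤ a) (hb : 0 < b) (hc : 0 < c) (hd : 0 < d) (he : 0 < e)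
    (hsum : a + b + c + d + e = 1) :
    ((a + b) * (c + d) + e * (a + b + c + d)) ^ (3 * ε - 1) *
      (a * b * c + a * b * d + a * c * d + b * c * d + a * b * e + b * c * e + c * d * e +
        a * d * e) ^ (-(1 + 2 * ε)) ≤
      125 * (b ^ (-(35 / 36) : ℝ) * (c ^ (-(35 / 36) : ℝ) *
        (d ^ (-(35 / 36) : ℝ) * e ^ (-(35 / 36) : ℝ)))) := by
  obtain ⟨h1, h2⟩ := hε
  have ha0 : 0 < a := by linarith
  set U := (a + b) * (c + d) + e * (a + b + c + d) with hU
  set C := a * b * c + a * b * d + a * c * d + b * c * d + a * b * e + b * c * e + c * d * e +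
        a * d * e with hC
  have hU0 : 0 < U := by positivity
  have hC0 : 0 < C := by positivity
  have key : ∀ x V : ℝ, 0 < x → a * x ≤ V → Real.log x - Real.log 5 ≤ Real.log V := by
    intro x V hx hV
    rw [← Real.log_div hx.ne' (by norm_num)]
    exact Real.log_le_log (by positivity) (by nlinarith)
  have hUc := key c U hc (by rw [← sub_nonneg, hU]; ring_nf; positivity)
  have hUd := key d U hd (by rw [← sub_nonneg, hU]; ring_nf; positivity)
  have hUe := key e U he (by rw [← sub_nonneg, hU]; ring_nf; positivity)
  have hbc := key (b * c) C (by positivity) (by rw [← sub_nonneg, hC]; ring_nf; positivity)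
  have hbe := key (b * e) C (by positivity) (by rw [← sub_nonneg, hC]; ring_nf; positivity)
  have hde := key (d * e) C (by positivity) (by rw [← sub_nonneg, hC]; ring_nf; positivity)
  have hcd := key (c * d) C (by positivity) (by rw [← sub_nonneg, hC]; ring_nf; positivity)
  rw [Real.log_mul (by positivity) (by positivity)] at hbc hbe hde hcd
  have lb := Real.log_nonpos hb.le (by linarith)
  have lc := Real.log_nonpos hc.le (by linarith)
  have ld := Real.log_nonpos hd.le (by linarith)
  have le := Real.log_nonpos he.le (by linarith)
  have l5 : 0 ≤ Real.log 5 := Real.log_nonneg (by norm_num)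
  have e125 : (125 : ℝ) = Real.exp (3 * Real.log 5) := by
    rw [mul_comm, ← Real.rpow_def_of_pos (by norm_num)]; norm_num
  rw [e125, Real.rpow_def_of_pos hU0, Real.rpow_def_of_pos hC0, Real.rpow_def_of_pos hb,
    Real.rpow_def_of_pos hc, Real.rpow_def_of_pos hd, Real.rpow_def_of_pos he]
  simp only [← Real.exp_add]
  apply Real.exp_le_exp.mpr
  have LU : 0 ≤ Real.log U - ((Real.log c + Real.log e) / 4 + Real.log d / 2 - Real.log 5) := by
    linarith
  have LC : 0 ≤ Real.log C - (2 / 3 * Real.log b + (Real.log c + Real.log e) / 2 +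
      Real.log d / 3 - Real.log 5) := by linarith
  have p1 := mul_nonneg (by linarith : 0 ≤ 1 - 3 * ε) LU
  have p2 := mul_nonneg (by linarith : 0 ≤ 1 + 2 * ε) LC
  have p3 := mul_nonneg (by linarith : 0 ≤ 35 / 36 - (2 / 3 + 4 / 3 * ε)) (neg_nonneg.mpr lb)
  have p4 := mul_nonneg (by linarith : 0 ≤ 35 / 36 - (3 / 4 + ε / 4)) (neg_nonneg.mpr lc)
  have p5 := mul_nonneg (by linarith : 0 ≤ 35 / 36 - (3 / 4 + ε / 4)) (neg_nonneg.mpr le)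
  have p6 := mul_nonneg (by linarith : 0 ≤ 35 / 36 - (5 / 6 - 5 / 6 * ε)) (neg_nonneg.mpr ld)
  have p7 := mul_nonneg (by linarith : 0 ≤ 3 - (2 - ε)) l5
  linarith

lemma five_bound_bridge {a b c d e ε : ℝ} (hε : ε ∈ Set.Ioo (-(1 : ℝ) / 6) (1 / 6))
    (ha : 0 < a) (hb : 0 < b) (hc : 0 < c) (hd : 0 < d) (he : 1 / 5 ≤ e)
    (hsum : a + b + c + d + e = 1) :
    ((a + b) * (c + d) + e * (a + b + c + d)) ^ (3 * ε - 1) *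
      (a * b * c + a * b * d + a * c * d + b * c * d + a * b * e + b * c * e + c * d * e +
        a * d * e) ^ (-(1 + 2 * ε)) ≤
      125 * (a ^ (-(35 / 36) : ℝ) * (b ^ (-(35 / 36) : ℝ) *
        (c ^ (-(35 / 36) : ℝ) * d ^ (-(35 / 36) : ℝ)))) := by
  obtain ⟨h1, h2⟩ := hε
  have he0 : 0 < e := by linarith
  set U := (a + b) * (c + d) + e * (a + b + c + d) with hU
  set C := a * b * c + a * b * d + a * c * d + b * c * d + a * b * e + b * c * e + c * d * e +
        a * d * e with hC
  have hU0 : 0 < U := by positivity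
  have hC0 : 0 < C := by positivity
  have key : ∀ x V : ℝ, 0 < x → e * x ≤ V → Real.log x - Real.log 5 ≤ Real.log V := by
    intro x V hx hV
    rw [← Real.log_div hx.ne' (by norm_num)]
    exact Real.log_le_log (by positivity) (by nlinarith)
  have hUa := key a U ha (by rw [← sub_nonneg, hU]; ring_nf; positivity)
  have hUb := key b U hb (by rw [← sub_nonneg, hU]; ring_nf; positivity)
  have hUc := key c U hc (by rw [← sub_nonneg, hU]; ring_nf; positivity)
  have hUd := key d U hd (by rw [← sub_nonneg, hU]; ring_nf; positivity)
  have hab := key (a * b) C (by positivity) (by rw [← sub_nonneg, hC]; ring_nf; positivity)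
  have hcd := key (c * d) C (by positivity) (by rw [← sub_nonneg, hC]; ring_nf; positivity)
  rw [Real.log_mul (by positivity) (by positivity)] at hab hcd
  have la := Real.log_nonpos ha.le (by linarith)
  have lb := Real.log_nonpos hb.le (by linarith)
  have lc := Real.log_nonpos hc.le (by linarith)
  have ld := Real.log_nonpos hd.le (by linarith)
  have l5 : 0 ≤ Real.log 5 := Real.log_nonneg (by norm_num)
  have e125 : (125 : ℝ) = Real.exp (3 * Real.log 5) := by
    rw [mul_comm, ← Real.rpow_def_of_pos (by norm_num)]; norm_num
  rw [e125, Real.rpow_def_of_pos hU0, Real.rpow_def_of_pos hC0, Real.rpow_def_of_pos ha,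
    Real.rpow_def_of_pos hb, Real.rpow_def_of_pos hc, Real.rpow_def_of_pos hd]
  simp only [← Real.exp_add]
  apply Real.exp_le_exp.mpr
  have LU : 0 ≤ Real.log U -
      ((Real.log a + Real.log b + Real.log c + Real.log d) / 4 - Real.log 5) := by linarith
  have LC : 0 ≤ Real.log C -
      ((Real.log a + Real.log b + Real.log c + Real.log d) / 2 - Real.log 5) := by linarith
  have p1 := mul_nonneg (by linarith : 0 ≤ 1 - 3 * ε) LU
  have p2 := mul_nonneg (by linarith : 0 ≤ 1 + 2 * ε) LC
  have p3 := mul_nonneg (by linarith : 0 ≤ 35 / 36 - (3 / 4 + ε / 4))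
    (by linarith : 0 ≤ -(Real.log a + Real.log b + Real.log c + Real.log d))
  have p4 := mul_nonneg (by linarith : 0 ≤ 3 - (2 - ε)) l5
  linarith

/-- Exchange of the two edges in each triangle, `z₁ ↔ z₂` and `z₃ ↔ z₄`. -/
def fiveSwap (z : ℝ × ℝ × ℝ × ℝ) : ℝ × ℝ × ℝ × ℝ := (z.2.1, z.1, z.2.2.2, z.2.2.1)

/-- Exchange of the two triangles, `z₁ ↔ z₃` and `z₂ ↔ z₄`. -/
def fiveFlip (z : ℝ × ℝ × ℝ × ℝ) : ℝ × ℝ × ℝ × ℝ := (z.2.2.1, z.2.2.2, z.1, z.2.1)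

/-- Exchange of `z₁` and `z₅`. -/
noncomputable def fiveExchange (z : ℝ × ℝ × ℝ × ℝ) : ℝ × ℝ × ℝ × ℝ := (fiveZ5 z, z.2)

lemma continuous_fiveZ5 : Continuous fiveZ5 := by unfold fiveZ5; fun_prop

lemma continuous_fiveU : Continuous fiveU := by unfold fiveU fiveZ5; fun_prop

lemma continuous_fiveC : Continuous fiveC := by unfold fiveC fiveZ5; fun_prop

lemma measurableSet_fiveT4 : MeasurableSet fiveT4 := by
  unfold fiveT4
  measurability

lemma fiveZ5_pos {z : ℝ × ℝ × ℝ × ℝ} (hz : z ∈ fiveT4) : 0 < fiveZ5 z := by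
  obtain ⟨-, -, -, -, h⟩ := hz
  unfold fiveZ5
  linarith

lemma fiveU_pos {z : ℝ × ℝ × ℝ × ℝ} (hz : z ∈ fiveT4) : 0 < fiveU z := by
  have h5 := fiveZ5_pos hz
  obtain ⟨h1, h2, h3, h4, -⟩ := hz
  unfold fiveU
  positivity

lemma fiveC_pos {z : ℝ × ℝ × ℝ × ℝ} (hz : z ∈ fiveT4) : 0 < fiveC z := by
  have h5 := fiveZ5_pos hz
  obtain ⟨h1, h2, h3, h4, -⟩ := hz
  unfold fiveC
  positivity

lemma measurePreserving_fiveSwap : MeasurePreserving fiveSwap volume volume := by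
  have hA := volume_preserving_prodAssoc (α₁ := ℝ) (β₁ := ℝ) (γ₁ := ℝ × ℝ)
  have hS := Measure.measurePreserving_swap (μ := (volume : Measure ℝ)) (ν := (volume : Measure ℝ))
  exact (hA.comp (hS.prod hS)).comp (hA.symm _)

lemma measurePreserving_fiveFlip : MeasurePreserving fiveFlip volume volume := by
  have hA := volume_preserving_prodAssoc (α₁ := ℝ) (β₁ := ℝ) (γ₁ := ℝ × ℝ)
  have hS := Measure.measurePreserving_swap (μ := (volume : Measure (ℝ × ℝ)))
    (ν := (volume : Measure (ℝ × ℝ)))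
  exact (hA.comp hS).comp (hA.symm _)

lemma measurePreserving_fiveExchange : MeasurePreserving fiveExchange volume volume := by
  have hS := Measure.measurePreserving_swap (μ := (volume : Measure ℝ))
    (ν := (volume : Measure (ℝ × ℝ × ℝ)))
  have hS' := Measure.measurePreserving_swap (μ := (volume : Measure (ℝ × ℝ × ℝ)))
    (ν := (volume : Measure ℝ))
  have hK : MeasurePreserving
      (fun p : (ℝ × ℝ × ℝ) × ℝ => (p.1, 1 - p.1.1 - p.1.2.1 - p.1.2.2 - p.2))
      (volume.prod volume) (volume.prod volume) :=
    (MeasurePreserving.id volume).skew_product (g := fun (w : ℝ × ℝ × ℝ) (a : ℝ) => 1 - w.1 - w.2.1 - w.2.2 - a)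
      (by unfold Function.uncurry; fun_prop)
      (Filter.Eventually.of_forall fun w => (Measure.measurePreserving_sub_left volume _).map_eq)
  convert! (hS'.comp hK).comp hS using 1
  funext z
  simp only [fiveExchange, fiveZ5, Function.comp, Prod.swap]
  congr 1
  ring

lemma fiveSwap_preimage : fiveSwap ⁻¹' fiveT4 = fiveT4 := by
  ext z
  simp only [fiveSwap, fiveT4, Set.mem_preimage, Set.mem_ofPred_eq]
  constructor <;> rintro ⟨h1, h2, h3, h4, h5⟩ <;> refine ⟨h2, h1, h4, h3, by linarith⟩

lemma fiveFlip_preimage : fiveFlip ⁻¹' fiveT4 = fiveT4 := by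
  ext z
  simp only [fiveFlip, fiveT4, Set.mem_preimage, Set.mem_ofPred_eq]
  constructor <;> rintro ⟨h1, h2, h3, h4, h5⟩ <;> refine ⟨h3, h4, h1, h2, by linarith⟩

lemma fiveExchange_preimage : fiveExchange ⁻¹' fiveT4 = fiveT4 := by
  ext z
  simp only [fiveExchange, fiveZ5, fiveT4, Set.mem_preimage, Set.mem_ofPred_eq]
  constructor <;> rintro ⟨h1, h2, h3, h4, h5⟩ <;>
    refine ⟨by linarith, h2, h3, h4, by linarith⟩

lemma fiveZ5_fiveSwap (z : ℝ × ℝ × ℝ × ℝ) : fiveZ5 (fiveSwap z) = fiveZ5 z := by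
  simp only [fiveZ5, fiveSwap]; ring

lemma fiveZ5_fiveFlip (z : ℝ × ℝ × ℝ × ℝ) : fiveZ5 (fiveFlip z) = fiveZ5 z := by
  simp only [fiveZ5, fiveFlip]; ring

lemma fiveU_fiveSwap (z : ℝ × ℝ × ℝ × ℝ) : fiveU (fiveSwap z) = fiveU z := by
  simp only [fiveU, fiveZ5_fiveSwap]; simp only [fiveSwap]; ring

lemma fiveU_fiveFlip (z : ℝ × ℝ × ℝ × ℝ) : fiveU (fiveFlip z) = fiveU z := by
  simp only [fiveU, fiveZ5_fiveFlip]; simp only [fiveFlip]; ring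

lemma fiveC_fiveSwap (z : ℝ × ℝ × ℝ × ℝ) : fiveC (fiveSwap z) = fiveC z := by
  simp only [fiveC, fiveZ5_fiveSwap]; simp only [fiveSwap]; ring

lemma fiveC_fiveFlip (z : ℝ × ℝ × ℝ × ℝ) : fiveC (fiveFlip z) = fiveC z := by
  simp only [fiveC, fiveZ5_fiveFlip]; simp only [fiveFlip]; ring

/-- Change of variables by a measure-preserving self-map of a set. -/
lemma integrableOn_comp_of_preimage_eq {α : Type*} [MeasurableSpace α] {μ : Measure α}
    {φ : α → α} {s : Set α} {f : α → ℝ} (hφ : MeasurePreserving φ μ μ) (hs : MeasurableSet s)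
    (hφs : φ ⁻¹' s = s) (hf : IntegrableOn f s μ) :
    IntegrableOn (fun z => f (φ z)) s μ ∧ ∫ z in s, f (φ z) ∂μ = ∫ z in s, f z ∂μ := by
  have h := hφ.restrict_preimage hs
  rw [hφs] at h
  refine ⟨(h.integrable_comp hf.1).mpr hf, ?_⟩
  conv_rhs => rw [← h.map_eq]
  exact (integral_map h.aemeasurable (by rw [h.map_eq]; exact hf.1)).symm

/-- The monomial `(z₁z₂z₃z₄)^(-35/36)`, which dominates the base integrand where `z₅ ≥ 1/5`. -/
noncomputable def fiveMonomial (z : ℝ × ℝ × ℝ × ℝ) : ℝ :=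
  z.1 ^ (-(35 / 36) : ℝ) * (z.2.1 ^ (-(35 / 36) : ℝ) *
    (z.2.2.1 ^ (-(35 / 36) : ℝ) * z.2.2.2 ^ (-(35 / 36) : ℝ)))

lemma fiveMonomial_nonneg {z : ℝ × ℝ × ℝ × ℝ} (hz : z ∈ fiveT4) : 0 ≤ fiveMonomial z := by
  obtain ⟨h1, h2, h3, h4, -⟩ := hz
  unfold fiveMonomial
  positivity

lemma integrableOn_fiveMonomial : IntegrableOn fiveMonomial fiveT4 volume := by
  have h : IntegrableOn (fun x : ℝ => x ^ (-(35 / 36) : ℝ)) (Set.Ioo 0 1) volume :=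
    (intervalIntegral.integrableOn_Ioo_rpow_iff one_pos).mpr (by norm_num)
  have H := h.integrable.mul_prod (h.integrable.mul_prod (h.integrable.mul_prod h.integrable))
  simp only [Measure.prod_restrict] at H
  refine IntegrableOn.mono_set (t := Set.Ioo 0 1 ×ˢ Set.Ioo 0 1 ×ˢ Set.Ioo 0 1 ×ˢ Set.Ioo 0 1)
    H ?_
  rintro ⟨a, b, c, d⟩ ⟨h1, h2, h3, h4, h5⟩
  simp only at h1 h2 h3 h4 h5
  simp only [Set.mem_prod, Set.mem_Ioo]
  refine ⟨⟨h1, ?_⟩, ⟨h2, ?_⟩, ⟨h3, ?_⟩, ⟨h4, ?_⟩⟩ <;> linarith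

lemma integrableOn_fiveU_fiveC {ε : ℝ} (hε : ε ∈ Set.Ioo (-(1 : ℝ) / 6) (1 / 6)) :
    IntegrableOn (fun z => fiveU z ^ (3 * ε - 1) * fiveC z ^ (-(1 + 2 * ε))) fiveT4 volume := by
  have m5 := integrableOn_fiveMonomial
  have m1 := (integrableOn_comp_of_preimage_eq measurePreserving_fiveExchange
    measurableSet_fiveT4 fiveExchange_preimage m5).1
  have m2 := (integrableOn_comp_of_preimage_eq measurePreserving_fiveSwap
    measurableSet_fiveT4 fiveSwap_preimage m1).1
  have m3 := (integrableOn_comp_of_preimage_eq measurePreserving_fiveFlip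
    measurableSet_fiveT4 fiveFlip_preimage m1).1
  have m4 := (integrableOn_comp_of_preimage_eq measurePreserving_fiveFlip
    measurableSet_fiveT4 fiveFlip_preimage m2).1
  refine Integrable.mono' ((((m1.add m2).add m3).add m4).add m5 |>.const_mul 125)
    (by
      have := continuous_fiveU.measurable
      have := continuous_fiveC.measurable
      fun_prop) ?_
  filter_upwards [ae_restrict_mem measurableSet_fiveT4] with z hz
  have hU := fiveU_pos hz
  have hC := fiveC_pos hz
  rw [Real.norm_of_nonneg (by positivity)]
  have n5 := fiveMonomial_nonneg hz
  have ex : ∀ w ∈ fiveT4, fiveExchange w ∈ fiveT4 := fun w hw => fiveExchange_preimage.ge hw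
  have hS : fiveSwap z ∈ fiveT4 := fiveSwap_preimage.ge hz
  have hF : fiveFlip z ∈ fiveT4 := fiveFlip_preimage.ge hz
  have hSF : fiveSwap (fiveFlip z) ∈ fiveT4 := fiveSwap_preimage.ge hF
  have n1 := fiveMonomial_nonneg (ex _ hz)
  have n2 := fiveMonomial_nonneg (ex _ hS)
  have n3 := fiveMonomial_nonneg (ex _ hF)
  have n4 := fiveMonomial_nonneg (ex _ hSF)
  have spoke : ∀ w ∈ fiveT4, 1 / 5 ≤ w.1 →
      fiveU w ^ (3 * ε - 1) * fiveC w ^ (-(1 + 2 * ε)) ≤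
        125 * fiveMonomial (fiveExchange w) := by
    intro w hw h
    have h5 := fiveZ5_pos hw
    obtain ⟨-, h2, h3, h4, -⟩ := hw
    refine (five_bound_spoke hε h h2 h3 h4 h5 (by unfold fiveZ5; ring)).trans (le_of_eq ?_)
    simp only [fiveMonomial, fiveExchange]
    ring
  simp only [Pi.add_apply]
  rcases le_or_gt (1 / 5) z.1 with h | h1
  · linarith [spoke z hz h]
  rcases le_or_gt (1 / 5) z.2.1 with h | h2
  · have := spoke _ hS h
    rw [fiveU_fiveSwap, fiveC_fiveSwap] at this
    linarith
  rcases le_or_gt (1 / 5) z.2.2.1 with h | h3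
  · have := spoke _ hF h
    rw [fiveU_fiveFlip, fiveC_fiveFlip] at this
    linarith
  rcases le_or_gt (1 / 5) z.2.2.2 with h | h4
  · have := spoke _ hSF h
    rw [fiveU_fiveSwap, fiveC_fiveSwap, fiveU_fiveFlip, fiveC_fiveFlip] at this
    linarith
  obtain ⟨p1, p2, p3, p4, -⟩ := hz
  have h5 : 1 / 5 ≤ fiveZ5 z := by unfold fiveZ5; linarith
  have : fiveU z ^ (3 * ε - 1) * fiveC z ^ (-(1 + 2 * ε)) ≤ 125 * fiveMonomial z :=
    five_bound_bridge hε p1 p2 p3 p4 h5 (by unfold fiveZ5; ring)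
  linarith

lemma integrableOn_fiveU_fiveC_of_le_fiveU {ε : ℝ} (hε : ε ∈ Set.Ioo (-(1 : ℝ) / 6) (1 / 6))
    {g : ℝ × ℝ × ℝ × ℝ → ℝ} (hg : Measurable g) (h0 : ∀ z ∈ fiveT4, 0 ≤ g z)
    (hle : ∀ z ∈ fiveT4, g z ≤ fiveU z) :
    IntegrableOn (fun z => g z * fiveU z ^ (3 * ε - 2) * fiveC z ^ (-(1 + 2 * ε)))
      fiveT4 volume := by
  refine Integrable.mono' (integrableOn_fiveU_fiveC hε)
    (by
      have := continuous_fiveU.measurable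
      have := continuous_fiveC.measurable
      fun_prop) ?_
  filter_upwards [ae_restrict_mem measurableSet_fiveT4] with z hz
  have hU := fiveU_pos hz
  have hC := fiveC_pos hz
  have hgz := h0 z hz
  rw [Real.norm_of_nonneg (by positivity), show 3 * ε - 1 = 1 + (3 * ε - 2) by ring,
    Real.rpow_add hU, Real.rpow_one]
  gcongr
  exact hle z hz

lemma integrableOn_fiveU_fiveC_of_le_fiveC {ε : ℝ} (hε : ε ∈ Set.Ioo (-(1 : ℝ) / 6) (1 / 6))
    {g : ℝ × ℝ × ℝ × ℝ → ℝ} (hg : Measurable g) (h0 : ∀ z ∈ fiveT4, 0 ≤ g z)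
    (hle : ∀ z ∈ fiveT4, g z ≤ fiveC z) :
    IntegrableOn (fun z => g z * fiveU z ^ (3 * ε - 1) * fiveC z ^ (-(2 + 2 * ε)))
      fiveT4 volume := by
  refine Integrable.mono' (integrableOn_fiveU_fiveC hε)
    (by
      have := continuous_fiveU.measurable
      have := continuous_fiveC.measurable
      fun_prop) ?_
  filter_upwards [ae_restrict_mem measurableSet_fiveT4] with z hz
  have hU := fiveU_pos hz
  have hC := fiveC_pos hz
  have hgz := h0 z hz
  rw [Real.norm_of_nonneg (by positivity), show -(1 + 2 * ε) = 1 + -(2 + 2 * ε) by ring,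
    Real.rpow_add hC, Real.rpow_one, mul_comm (g z), mul_assoc]
  gcongr
  exact hle z hz

/-- Fubini along the rays `t ↦ (t, t • w)`. -/
lemma integral_eq_integral_rays {g : ℝ × ℝ × ℝ × ℝ → ℝ} (hm : Measurable g) (hg : Integrable g)
    (h0 : ∀ z, z.1 ≤ 0 → g z = 0) :
    (∀ᵐ w : ℝ × ℝ × ℝ, IntegrableOn (fun t => t ^ 3 * g (t, t • w)) (Set.Ioi 0)) ∧
      ∫ z, g z = ∫ w : ℝ × ℝ × ℝ, ∫ t in Set.Ioi 0, t ^ 3 * g (t, t • w) := by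
  rw [Measure.volume_eq_prod] at hg
  have hH2 : (volume : Measure (ℝ × ℝ)).IsAddHaarMeasure :=
    Measure.prod.instIsAddHaarMeasure volume volume
  have hH3 : (volume : Measure (ℝ × ℝ × ℝ)).IsAddHaarMeasure :=
    Measure.prod.instIsAddHaarMeasure volume volume
  have hfin : Module.finrank ℝ (ℝ × ℝ × ℝ) = 3 := by simp
  have scale : ∀ t : ℝ, 0 < t → ∀ k : ℝ × ℝ × ℝ → ℝ,
      ∫ w, t ^ 3 * k (t • w) = ∫ v, k v := by
    intro t ht k
    rw [integral_const_mul, Measure.integral_comp_smul, hfin, abs_of_pos (by positivity),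
      smul_eq_mul, ← mul_assoc, mul_inv_cancel₀ (by positivity), one_mul]
  have hInt : Integrable (fun p : ℝ × ℝ × ℝ × ℝ => p.1 ^ 3 * g (p.1, p.1 • p.2))
      ((volume.restrict (Set.Ioi 0)).prod volume) := by
    rw [integrable_prod_iff (by fun_prop)]
    constructor
    · filter_upwards [ae_restrict_of_ae hg.prod_right_ae, ae_restrict_mem measurableSet_Ioi]
        with t h ht
      exact (h.comp_smul (ne_of_gt ht)).const_mul _
    · refine Integrable.congr (f := fun t => ∫ v, ‖g (t, v)‖) hg.integral_norm_prod_left.restrict ?_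
      filter_upwards [ae_restrict_mem measurableSet_Ioi] with t ht
      have ht : 0 < t := ht
      rw [← scale t ht]
      refine integral_congr_ae (Filter.Eventually.of_forall fun w => ?_)
      simp only [norm_mul, norm_pow, Real.norm_of_nonneg ht.le]
  refine ⟨hInt.prod_left_ae, ?_⟩
  rw [Measure.volume_eq_prod, integral_prod _ hg,
    ← setIntegral_eq_integral_of_forall_compl_eq_zero (s := Set.Ioi (0 : ℝ))
      (fun t ht => by simp [h0 (t, _) (not_lt.mp ht)])]
  rw [← integral_integral_swap (f := fun t w => t ^ 3 * g (t, t • w)) hInt]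
  refine setIntegral_congr_fun measurableSet_Ioi fun t ht => ?_
  exact (scale t ht fun v => g (t, v)).symm

/-- The divergence of the vector field `z₅ U^(3ε-1) C^(-(1+2ε)) ∂/∂z₅`. -/
noncomputable def fiveDivergence (ε : ℝ) (z : ℝ × ℝ × ℝ × ℝ) : ℝ :=
  fiveU z ^ (3 * ε - 1) * fiveC z ^ (-(1 + 2 * ε)) +
    (3 * ε - 1) * (fiveZ5 z * (z.1 + z.2.1 + z.2.2.1 + z.2.2.2) *
      fiveU z ^ (3 * ε - 2) * fiveC z ^ (-(1 + 2 * ε))) -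
    (1 + 2 * ε) * (fiveZ5 z * ((z.1 + z.2.2.1) * (z.2.1 + z.2.2.2)) *
      fiveU z ^ (3 * ε - 1) * fiveC z ^ (-(2 + 2 * ε)))

lemma fiveDivergence_ray {ε t x y v σ u q c : ℝ} (ht : 0 < t)
    (hσ : σ = 1 + x + y + v) (hu : u = (1 + x) * (y + v)) (hq : q = (1 + y) * (x + v))
    (hc : c = x * y + x * v + y * v + x * y * v)
    (hA : 0 < t * u + (1 - t * σ) * σ) (hB : 0 < t * c + (1 - t * σ) * q) :
    t ^ 3 * fiveDivergence ε (t, t * x, t * y, t * v) =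
      t ^ (-ε) * (t * u + (1 - t * σ) * σ) ^ (3 * ε - 2) *
          (t * c + (1 - t * σ) * q) ^ (-(2 + 2 * ε)) *
        ((t * u + (1 - t * σ) * σ) * (t * c + (1 - t * σ) * q) +
          (3 * ε - 1) * ((1 - t * σ) * σ) * (t * c + (1 - t * σ) * q) -
          (1 + 2 * ε) * ((1 - t * σ) * q) * (t * u + (1 - t * σ) * σ)) := by
  set A := t * u + (1 - t * σ) * σ with hAd
  set B := t * c + (1 - t * σ) * q with hBd
  have h5 : fiveZ5 (t, t * x, t * y, t * v) = 1 - t * σ := by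
    simp only [fiveZ5, hσ]; ring
  have hU : fiveU (t, t * x, t * y, t * v) = t * A := by
    simp only [fiveU, h5]; rw [hAd, hu, hσ]; ring
  have hC : fiveC (t, t * x, t * y, t * v) = t ^ 2 * B := by
    simp only [fiveC, h5]; rw [hBd, hq, hc, hσ]; ring
  have eU : (t * A) ^ (3 * ε - 1) = t * A * (t * A) ^ (3 * ε - 2) := by
    rw [show 3 * ε - 1 = 1 + (3 * ε - 2) by ring, Real.rpow_add (by positivity), Real.rpow_one]
  have eC : (t ^ 2 * B) ^ (-(1 + 2 * ε)) = t ^ 2 * B * (t ^ 2 * B) ^ (-(2 + 2 * ε)) := by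
    rw [show -(1 + 2 * ε) = 1 + -(2 + 2 * ε) by ring, Real.rpow_add (by positivity),
      Real.rpow_one]
  have ht2 : (t ^ 2) ^ (-(2 + 2 * ε)) = t ^ (-(4 + 4 * ε)) := by
    rw [← Real.rpow_natCast, ← Real.rpow_mul ht.le]; congr 1; push_cast; ring
  have hts : t ^ (-ε) = t ^ 6 * (t ^ (3 * ε - 2) * t ^ (-(4 + 4 * ε))) := by
    rw [← Real.rpow_natCast, ← Real.rpow_add ht, ← Real.rpow_add ht]; congr 1; push_cast; ring
  simp only [fiveDivergence, h5, hU, hC]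
  rw [eU, eC, Real.mul_rpow ht.le hA.le, Real.mul_rpow (by positivity) hB.le, ht2, hts,
    show t + t * x + t * y + t * v = t * σ by rw [hσ]; ring,
    show (t + t * y) * (t * x + t * v) = t ^ 2 * q by rw [hq]; ring]
  ring

lemma hasDerivAt_ray {ε t σ u q c : ℝ} (ht : 0 < t)
    (hA : 0 < t * u + (1 - t * σ) * σ) (hB : 0 < t * c + (1 - t * σ) * q) :
    HasDerivAt (fun t : ℝ => (1 - t * σ) * t ^ (1 - ε) *
        (t * u + (1 - t * σ) * σ) ^ (3 * ε - 1) * (t * c + (1 - t * σ) * q) ^ (-(1 + 2 * ε)))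
      (-(t ^ (-ε) * (t * u + (1 - t * σ) * σ) ^ (3 * ε - 2) *
          (t * c + (1 - t * σ) * q) ^ (-(2 + 2 * ε)) *
        ((t * u + (1 - t * σ) * σ) * (t * c + (1 - t * σ) * q) +
          (3 * ε - 1) * ((1 - t * σ) * σ) * (t * c + (1 - t * σ) * q) -
          (1 + 2 * ε) * ((1 - t * σ) * q) * (t * u + (1 - t * σ) * σ)))) t := by
  have d1 : HasDerivAt (fun t : ℝ => 1 - t * σ) (-σ) t := by
    simpa using ((hasDerivAt_id t).mul_const σ).const_sub 1
  have dlin : ∀ m n : ℝ, HasDerivAt (fun t : ℝ => t * m + (1 - t * σ) * n) (m - σ * n) t := by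
    intro m n
    convert! ((hasDerivAt_id t).mul_const m).add (d1.mul_const n) using 1
    ring
  have dt := (hasDerivAt_id t).rpow_const (p := 1 - ε) (Or.inl ht.ne')
  have dA := (dlin u σ).rpow_const (p := 3 * ε - 1) (Or.inl hA.ne')
  have dB := (dlin c q).rpow_const (p := -(1 + 2 * ε)) (Or.inl hB.ne')
  convert! ((d1.mul dt).mul dA).mul dB using 1
  simp only [id]
  have et : t ^ (1 - ε) = t * t ^ (-ε) := by
    rw [show 1 - ε = 1 + -ε by ring, Real.rpow_add ht, Real.rpow_one]
  have eA : (t * u + (1 - t * σ) * σ) ^ (3 * ε - 1) =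
      (t * u + (1 - t * σ) * σ) * (t * u + (1 - t * σ) * σ) ^ (3 * ε - 2) := by
    rw [show 3 * ε - 1 = 1 + (3 * ε - 2) by ring, Real.rpow_add hA, Real.rpow_one]
  have eB : (t * c + (1 - t * σ) * q) ^ (-(1 + 2 * ε)) =
      (t * c + (1 - t * σ) * q) * (t * c + (1 - t * σ) * q) ^ (-(2 + 2 * ε)) := by
    rw [show -(1 + 2 * ε) = 1 + -(2 + 2 * ε) by ring, Real.rpow_add hB, Real.rpow_one]
  simp only [Pi.mul_apply]
  rw [et, eA, eB, show 1 - ε - 1 = -ε by ring, show 3 * ε - 1 - 1 = 3 * ε - 2 by ring,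
    show -(1 + 2 * ε) - 1 = -(2 + 2 * ε) by ring]
  ring

lemma integral_fiveDivergence_ray {ε : ℝ} (hε : ε < 1) {x y v : ℝ} (hx : 0 < x) (hy : 0 < y)
    (hv : 0 < v)
    (hInt : IntegrableOn (fun t => t ^ 3 * fiveDivergence ε (t, t * x, t * y, t * v))
      (Set.Ioo 0 (1 + x + y + v)⁻¹)) :
    ∫ t in Set.Ioo 0 (1 + x + y + v)⁻¹, t ^ 3 * fiveDivergence ε (t, t * x, t * y, t * v) = 0 := by
  obtain ⟨σ, hσ⟩ : ∃ σ, σ = 1 + x + y + v := ⟨_, rfl⟩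
  obtain ⟨u, hu⟩ : ∃ u, u = (1 + x) * (y + v) := ⟨_, rfl⟩
  obtain ⟨q, hq⟩ : ∃ q, q = (1 + y) * (x + v) := ⟨_, rfl⟩
  obtain ⟨c, hc⟩ : ∃ c, c = x * y + x * v + y * v + x * y * v := ⟨_, rfl⟩
  have hσ0 : 0 < σ := by rw [hσ]; positivity
  have hu0 : 0 < u := by rw [hu]; positivity
  have hq0 : 0 < q := by rw [hq]; positivity
  have hc0 : 0 < c := by rw [hc]; positivity
  rw [← hσ] at hInt ⊢
  have pos : ∀ m n : ℝ, 0 < m → 0 < n → ∀ t ∈ Set.Icc 0 σ⁻¹, 0 < t * m + (1 - t * σ) * n := by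
    intro m n hm hn t ht
    have h1 : t * σ ≤ 1 := by
      calc t * σ ≤ σ⁻¹ * σ := by gcongr; exact ht.2
        _ = 1 := inv_mul_cancel₀ hσ0.ne'
    rcases ht.1.eq_or_lt with h | h
    · subst h; simpa using hn
    · have : 0 ≤ (1 - t * σ) * n := mul_nonneg (by linarith) hn.le
      positivity
  have hT : 0 < σ⁻¹ := inv_pos.mpr hσ0
  have hInt' : IntervalIntegrable
      (fun t => -(t ^ 3 * fiveDivergence ε (t, t * x, t * y, t * v))) volume 0 σ⁻¹ := by
    rw [intervalIntegrable_iff_integrableOn_Ioo_of_le hT.le]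
    exact hInt.neg
  have ftc := intervalIntegral.integral_eq_sub_of_hasDerivAt_of_le (f := fun t : ℝ =>
      (1 - t * σ) * t ^ (1 - ε) * (t * u + (1 - t * σ) * σ) ^ (3 * ε - 1) *
        (t * c + (1 - t * σ) * q) ^ (-(1 + 2 * ε))) hT.le ?_ ?_ hInt'
  · rw [intervalIntegral.integral_of_le hT.le, integral_Ioc_eq_integral_Ioo, integral_neg,
      inv_mul_cancel₀ hσ0.ne', Real.zero_rpow (by linarith)] at ftc
    linarith
  · refine ((ContinuousOn.mul (by fun_prop) ?_).mul ?_).mul ?_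
    · exact continuousOn_id.rpow_const fun t _ => Or.inr (by linarith)
    · exact ContinuousOn.rpow_const (by fun_prop) fun t ht => Or.inl (pos u σ hu0 hσ0 t ht).ne'
    · exact ContinuousOn.rpow_const (by fun_prop) fun t ht => Or.inl (pos c q hc0 hq0 t ht).ne'
  · intro t ht
    have hA := pos u σ hu0 hσ0 t (Set.Ioo_subset_Icc_self ht)
    have hB := pos c q hc0 hq0 t (Set.Ioo_subset_Icc_self ht)
    rw [fiveDivergence_ray ht.1 hσ hu hq hc hA hB]
    exact hasDerivAt_ray ht.1 hA hB

lemma integral_fiveDivergence {ε : ℝ} (hε : ε < 1)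
    (hInt : IntegrableOn (fiveDivergence ε) fiveT4 volume) :
    ∫ z in fiveT4, fiveDivergence ε z = 0 := by
  have hm : Measurable (fiveDivergence ε) := by
    have := continuous_fiveU.measurable
    have := continuous_fiveC.measurable
    have := continuous_fiveZ5.measurable
    unfold fiveDivergence
    fun_prop
  obtain ⟨hae, heq⟩ := integral_eq_integral_rays (hm.indicator measurableSet_fiveT4)
    (hInt.integrable_indicator measurableSet_fiveT4)
    (fun z hz => Set.indicator_of_notMem (fun h => not_lt.mpr hz h.1) _)
  rw [← integral_indicator measurableSet_fiveT4, heq]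
  refine integral_eq_zero_of_ae ?_
  filter_upwards [hae] with w hw
  obtain ⟨x, y, v⟩ := w
  simp only [Prod.smul_mk, smul_eq_mul] at hw ⊢
  by_cases hpos : 0 < x ∧ 0 < y ∧ 0 < v
  · obtain ⟨hx, hy, hv⟩ := hpos
    have hσ0 : 0 < 1 + x + y + v := by positivity
    have hind : Set.EqOn (fun t => t ^ 3 *
          fiveT4.indicator (fiveDivergence ε) (t, t * x, t * y, t * v))
        ((Set.Ioo 0 (1 + x + y + v)⁻¹).indicator
          fun t => t ^ 3 * fiveDivergence ε (t, t * x, t * y, t * v)) (Set.Ioi 0) := by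
      intro t ht
      have ht : 0 < t := ht
      have hiff : (t, t * x, t * y, t * v) ∈ fiveT4 ↔ t ∈ Set.Ioo 0 (1 + x + y + v)⁻¹ := by
        rw [Set.mem_Ioo, lt_inv_comm₀ ht hσ0, inv_eq_one_div, lt_div_iff₀ ht]
        constructor
        · rintro ⟨-, -, -, -, h⟩
          exact ⟨ht, by simp only at h; linarith⟩
        · rintro ⟨-, h⟩
          exact ⟨ht, mul_pos ht hx, mul_pos ht hy, mul_pos ht hv, by simp only; linarith⟩
      by_cases h : t ∈ Set.Ioo 0 (1 + x + y + v)⁻¹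
      · simp only [Set.indicator_of_mem h, Set.indicator_of_mem (hiff.mpr h)]
      · simp only [Set.indicator_of_notMem h, Set.indicator_of_notMem (mt hiff.mp h), mul_zero]
    have hsub : Set.Ioi (0 : ℝ) ∩ Set.Ioo 0 (1 + x + y + v)⁻¹ = Set.Ioo 0 (1 + x + y + v)⁻¹ :=
      Set.inter_eq_right.mpr fun t ht => ht.1
    rw [setIntegral_congr_fun measurableSet_Ioi hind, setIntegral_indicator measurableSet_Ioo,
      hsub]
    refine integral_fiveDivergence_ray hε hx hy hv ?_
    rw [integrableOn_congr_fun hind measurableSet_Ioi, IntegrableOn,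
      integrable_indicator_iff measurableSet_Ioo, IntegrableOn,
      Measure.restrict_restrict measurableSet_Ioo, Set.inter_comm, hsub] at hw
    exact hw
  · refine setIntegral_eq_zero_of_forall_eq_zero fun t ht => ?_
    have ht : 0 < t := ht
    rw [Set.indicator_of_notMem, mul_zero]
    rintro ⟨-, h2, h3, h4, -⟩
    exact hpos ⟨(mul_pos_iff_of_pos_left ht).mp h2, (mul_pos_iff_of_pos_left ht).mp h3,
      (mul_pos_iff_of_pos_left ht).mp h4⟩

lemma integrableOn_add_four {α : Type*} [MeasurableSpace α] {μ : Measure α} {s : Set α}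
    {f g h k : α → ℝ} (hf : IntegrableOn f s μ) (hg : IntegrableOn g s μ)
    (hh : IntegrableOn h s μ) (hk : IntegrableOn k s μ) :
    IntegrableOn (fun z => f z + g z + h z + k z) s μ ∧
      ∫ z in s, (f z + g z + h z + k z) ∂μ =
        ∫ z in s, f z ∂μ + ∫ z in s, g z ∂μ + ∫ z in s, h z ∂μ + ∫ z in s, k z ∂μ := by
  have hfg : IntegrableOn (fun z => f z + g z) s μ := hf.add hg
  have hfgh : IntegrableOn (fun z => f z + g z + h z) s μ := hfg.add hh
  refine ⟨hfgh.add hk, ?_⟩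
  rw [integral_add hfgh hk, integral_add hfg hh, integral_add hf hg]

/-- Two-loop parameter-space IBP identity (vanishing boundary term) for the
five-edge two-point diagram:
`I(1,1,1,1,1;−1+3ε) − 4(1−3ε) I(1,1,2,1,2;−2+3ε)
  = (1+2ε)[2 I(1,1,2,2,2;−1+3ε) + 2 I(1,2,2,1,2;−1+3ε)]`. -/
theorem five_edge_ibp_a (ε : ℝ) (hε : ε ∈ Set.Ioo (-(1 : ℝ) / 6) (1 / 6)) :
    IntegrableOn (fun z => fiveU z ^ (3 * ε - 1) * fiveC z ^ (-(1 + 2 * ε))) fiveT4 volume ∧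
    IntegrableOn (fun z => z.2.2.1 * fiveZ5 z * fiveU z ^ (3 * ε - 2) * fiveC z ^ (-(1 + 2 * ε)))
      fiveT4 volume ∧
    IntegrableOn
      (fun z => z.2.2.1 * z.2.2.2 * fiveZ5 z * fiveU z ^ (3 * ε - 1) * fiveC z ^ (-(2 + 2 * ε)))
      fiveT4 volume ∧
    IntegrableOn
      (fun z => z.2.1 * z.2.2.1 * fiveZ5 z * fiveU z ^ (3 * ε - 1) * fiveC z ^ (-(2 + 2 * ε)))
      fiveT4 volume ∧
    (∫ z in fiveT4, fiveU z ^ (3 * ε - 1) * fiveC z ^ (-(1 + 2 * ε)))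
        - 4 * (1 - 3 * ε) *
          (∫ z in fiveT4, z.2.2.1 * fiveZ5 z * fiveU z ^ (3 * ε - 2) * fiveC z ^ (-(1 + 2 * ε)))
      = (1 + 2 * ε) *
          (2 * (∫ z in fiveT4,
              z.2.2.1 * z.2.2.2 * fiveZ5 z * fiveU z ^ (3 * ε - 1) * fiveC z ^ (-(2 + 2 * ε)))
            + 2 * ∫ z in fiveT4,
              z.2.1 * z.2.2.1 * fiveZ5 z * fiveU z ^ (3 * ε - 1) * fiveC z ^ (-(2 + 2 * ε))) := by
  have hZ := continuous_fiveZ5.measurable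
  have I1 := integrableOn_fiveU_fiveC hε
  have I2 : IntegrableOn (fun z => z.2.2.1 * fiveZ5 z * fiveU z ^ (3 * ε - 2) *
      fiveC z ^ (-(1 + 2 * ε))) fiveT4 volume := by
    refine integrableOn_fiveU_fiveC_of_le_fiveU hε (g := fun z => z.2.2.1 * fiveZ5 z)
      (by fun_prop) ?_ ?_ <;> intro z hz <;> have h5 := fiveZ5_pos hz <;>
      obtain ⟨h1, h2, h3, h4, -⟩ := hz
    · positivity
    · rw [← sub_nonneg, fiveU]; ring_nf; positivity
  have I3 : IntegrableOn (fun z => z.2.2.1 * z.2.2.2 * fiveZ5 z * fiveU z ^ (3 * ε - 1) *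
      fiveC z ^ (-(2 + 2 * ε))) fiveT4 volume := by
    refine integrableOn_fiveU_fiveC_of_le_fiveC hε (g := fun z => z.2.2.1 * z.2.2.2 * fiveZ5 z)
      (by fun_prop) ?_ ?_ <;> intro z hz <;> have h5 := fiveZ5_pos hz <;>
      obtain ⟨h1, h2, h3, h4, -⟩ := hz
    · positivity
    · rw [← sub_nonneg, fiveC]; ring_nf; positivity
  have I4 : IntegrableOn (fun z => z.2.1 * z.2.2.1 * fiveZ5 z * fiveU z ^ (3 * ε - 1) *
      fiveC z ^ (-(2 + 2 * ε))) fiveT4 volume := by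
    refine integrableOn_fiveU_fiveC_of_le_fiveC hε (g := fun z => z.2.1 * z.2.2.1 * fiveZ5 z)
      (by fun_prop) ?_ ?_ <;> intro z hz <;> have h5 := fiveZ5_pos hz <;>
      obtain ⟨h1, h2, h3, h4, -⟩ := hz
    · positivity
    · rw [← sub_nonneg, fiveC]; ring_nf; positivity
  refine ⟨I1, I2, I3, I4, ?_⟩
  set f1 : ℝ × ℝ × ℝ × ℝ → ℝ := fun z => fiveU z ^ (3 * ε - 1) * fiveC z ^ (-(1 + 2 * ε)) with hf1
  set f2 : ℝ × ℝ × ℝ × ℝ → ℝ := fun z =>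
    z.2.2.1 * fiveZ5 z * fiveU z ^ (3 * ε - 2) * fiveC z ^ (-(1 + 2 * ε)) with hf2
  set f3 : ℝ × ℝ × ℝ × ℝ → ℝ := fun z =>
    z.2.2.1 * z.2.2.2 * fiveZ5 z * fiveU z ^ (3 * ε - 1) * fiveC z ^ (-(2 + 2 * ε)) with hf3
  set f4 : ℝ × ℝ × ℝ × ℝ → ℝ := fun z =>
    z.2.1 * z.2.2.1 * fiveZ5 z * fiveU z ^ (3 * ε - 1) * fiveC z ^ (-(2 + 2 * ε)) with hf4
  have swap {f : ℝ × ℝ × ℝ × ℝ → ℝ} (hf : IntegrableOn f fiveT4 volume) :=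
    integrableOn_comp_of_preimage_eq measurePreserving_fiveSwap measurableSet_fiveT4
      fiveSwap_preimage hf
  have flip {f : ℝ × ℝ × ℝ × ℝ → ℝ} (hf : IntegrableOn f fiveT4 volume) :=
    integrableOn_comp_of_preimage_eq measurePreserving_fiveFlip measurableSet_fiveT4
      fiveFlip_preimage hf
  obtain ⟨I2s, e2s⟩ := swap I2
  obtain ⟨I2f, e2f⟩ := flip I2
  obtain ⟨I2sf, e2sf⟩ := flip I2s
  obtain ⟨I3f, e3f⟩ := flip I3
  obtain ⟨I4s, e4s⟩ := swap I4
  have decomp : fiveDivergence ε = fun z => f1 z +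
      (3 * ε - 1) * (f2 z + f2 (fiveSwap z) + f2 (fiveFlip z) + f2 (fiveSwap (fiveFlip z))) -
      (1 + 2 * ε) * (f3 z + f3 (fiveFlip z) + f4 z + f4 (fiveSwap z)) := by
    funext z
    simp only [hf1, hf2, hf3, hf4, fiveU_fiveSwap, fiveU_fiveFlip, fiveC_fiveSwap, fiveC_fiveFlip,
      fiveZ5_fiveSwap, fiveZ5_fiveFlip]
    simp only [fiveDivergence, fiveSwap, fiveFlip]
    ring
  obtain ⟨J2, s2⟩ := integrableOn_add_four I2 I2s I2f I2sf
  obtain ⟨J3, s3⟩ := integrableOn_add_four I3 I3f I4 I4s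
  have J12 : IntegrableOn (fun z => f1 z + (3 * ε - 1) *
      (f2 z + f2 (fiveSwap z) + f2 (fiveFlip z) + f2 (fiveSwap (fiveFlip z)))) fiveT4 volume :=
    I1.add (J2.const_mul _)
  have main := integral_fiveDivergence (ε := ε) (by linarith [hε.2])
    (by rw [decomp]; exact J12.sub (J3.const_mul _))
  rw [decomp, integral_sub J12 (J3.const_mul _), integral_add I1 (J2.const_mul _),
    integral_const_mul, integral_const_mul, s2, s3, e2sf, e2f, e2s, e3f, e4s] at main
  linarith
end

section
/- Fix ε ∈ (−1/6, 1/6). On the open simplex T₄ = {(z₁,z₂,z₃,z₄) ∈ (0,∞)⁴ : z₁+z₂+z₃+z₄ < 1}, with z₅ := 1−z₁−z₂−z₃−z₄, U := (z₁+z₂)(z₃+z₄) + z₅(z₁+z₂+z₃+z₄) > 0 and C := z₁z₂z₃ + z₁z₂z₄ + z₁z₃z₄ + z₂z₃z₄ + z₁z₂z₅ + z₂z₃z₅ + z₃z₄z₅ + z₁z₄z₅ > 0, all the integrands below are Lebesgue integrable on T₄ and ∫_{T₄} U^{3ε−1} C^{−(1+2ε)} − (1−3ε)·[ ∫_{T₄}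 z₂z₃ U^{3ε−2} C^{−(1+2ε)} + ∫_{T₄} z₂z₄ U^{3ε−2} C^{−(1+2ε)} + ∫_{T₄} z₃z₅ U^{3ε−2} C^{−(1+2ε)} ] = (1+2ε)·[ 2·∫_{T₄} z₂z₃z₄ U^{3ε−1} C^{−(2+2ε)} + ∫_{T₄} z₁z₂z₄ U^{3ε−1} C^{−(2+2ε)} + ∫_{T₄} z₂z₃z₅ U^{3ε−1} C^{−(2+2ε)} + ∫_{T₄} z₃z₄z₅ U^{3ε−1} C^{−(2+2ε)} ]. -/
open MeasureTheory

open Module in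
/-- If `t ↦ tⁿ h(t z)` has derivative `tⁿ⁻¹ k(t z)` along every ray, where `n` is the dimension,
then `k` is a total divergence and its integral vanishes. -/
lemma integral_eq_zero_of_hasDerivAt_smul {E : Type*} [NormedAddCommGroup E] [NormedSpace ℝ E]
    [MeasurableSpace E] [BorelSpace E] [FiniteDimensional ℝ E] (μ : Measure E)
    [μ.IsAddHaarMeasure] {h k : E → ℝ} (hh : Integrable h μ) (hk : Integrable k μ)
    (hkm : Measurable k)
    (hc : ∀ z, ContinuousOn (fun t : ℝ => t ^ finrank ℝ E * h (t • z)) (Set.Icc 1 2))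
    (hd : ∀ z, ∃ s : Set ℝ, s.Countable ∧ ∀ t ∈ Set.Ioo (1 : ℝ) 2 \ s,
      HasDerivAt (fun t : ℝ => t ^ finrank ℝ E * h (t • z))
        (t ^ finrank ℝ E * t⁻¹ * k (t • z)) t) :
    ∫ z, k z ∂μ = 0 := by
  set n := finrank ℝ E with hn
  have hpos : ∀ t ∈ Set.uIoc (1 : ℝ) 2, 0 < t := fun t ht => by
    rw [Set.uIoc_of_le (by norm_num)] at ht
    linarith [ht.1]
  have habs : ∀ t : ℝ, 0 < t → |(t ^ n)⁻¹| = (t ^ n)⁻¹ := fun t ht => abs_of_pos (by positivity)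
  have hint : Integrable (Function.uncurry fun (t : ℝ) (z : E) => t ^ n * t⁻¹ * k (t • z))
      ((volume.restrict (Set.uIoc 1 2)).prod μ) := by
    rw [integrable_prod_iff]
    · constructor
      · filter_upwards [ae_restrict_mem measurableSet_uIoc] with t ht
        change Integrable (fun z => t ^ n * t⁻¹ * k (t • z)) μ
        exact (hk.comp_smul (hpos t ht).ne').const_mul _
      · have : IntervalIntegrable (fun t : ℝ => t⁻¹ * ∫ z, ‖k z‖ ∂μ) volume 1 2 :=
          (continuousOn_id.inv₀ fun t ht => by
            rw [Set.uIcc_of_le (by norm_num)] at ht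
            exact (zero_lt_one.trans_le ht.1).ne').intervalIntegrable.mul_const _
        refine (intervalIntegrable_iff.1 this).congr ?_
        filter_upwards [ae_restrict_mem measurableSet_uIoc] with t ht
        have ht0 := hpos t ht
        have := Measure.integral_comp_smul μ (fun z => ‖k z‖) t
        rw [← hn, habs t ht0, smul_eq_mul] at this
        simp only [Function.uncurry, norm_mul]
        rw [integral_const_mul, this, Real.norm_of_nonneg (by positivity),
          Real.norm_of_nonneg (by positivity)]
        field_simp
    · apply Measurable.aestronglyMeasurable
      simp only [Function.uncurry_def]
      fun_prop
  have hswap := intervalIntegral_integral_swap hint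
  have hleft : ∀ t ∈ Set.uIcc (1 : ℝ) 2,
      ∫ z, t ^ n * t⁻¹ * k (t • z) ∂μ = t⁻¹ * ∫ z, k z ∂μ := by
    intro t ht
    rw [Set.uIcc_of_le (by norm_num)] at ht
    have ht0 : 0 < t := by linarith [ht.1]
    rw [integral_const_mul, Measure.integral_comp_smul, ← hn, habs t ht0, smul_eq_mul]
    field_simp
  rw [intervalIntegral.integral_congr hleft, intervalIntegral.integral_mul_const,
    integral_inv_of_pos (by norm_num) (by norm_num)] at hswap
  have hright : ∀ᵐ z ∂μ, ∫ t in (1 : ℝ)..2, t ^ n * t⁻¹ * k (t • z)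
      = 2 ^ n * h ((2 : ℝ) • z) - h z := by
    filter_upwards [hint.prod_left_ae] with z hz
    obtain ⟨s, hs, hd⟩ := hd z
    rw [integral_eq_of_hasDerivAt_off_countable_of_le _ _ (by norm_num) hs (hc z) hd
      (intervalIntegrable_iff.2 hz)]
    simp
  rw [integral_congr_ae hright, integral_sub ((hh.comp_smul two_ne_zero).const_mul _) hh,
    integral_const_mul, Measure.integral_comp_smul, ← hn, habs 2 two_pos, smul_eq_mul,
    mul_inv_cancel_left₀ (by positivity), sub_self] at hswap
  refine (mul_eq_zero.1 hswap).resolve_left (Real.log_pos (by norm_num)).ne'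

/-- An affine involution preserves any additive Haar measure. -/
lemma measurePreserving_of_involutive_affine {E : Type*} [NormedAddCommGroup E] [NormedSpace ℝ E]
    [MeasurableSpace E] [BorelSpace E] [FiniteDimensional ℝ E] (μ : Measure E)
    [μ.IsAddHaarMeasure] (L : E →ₗ[ℝ] E) (c : E)
    (hL : Function.Involutive fun z => c + L z) :
    MeasurePreserving (fun z => c + L z) μ μ := by
  have hLL : L * L = 1 := by
    ext z
    have h0 := hL 0
    have hz := hL z
    simp only [map_zero, add_zero, map_add] at h0 hz
    rw [← add_assoc, h0, zero_add] at hz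
    simpa using hz
  have hdet : LinearMap.det L * LinearMap.det L = 1 := by
    rw [← map_mul, hLL, map_one]
  have habs : |(LinearMap.det L)⁻¹| = 1 := by
    rcases mul_self_eq_one_iff.1 hdet with h | h <;> simp [h]
  have hpres : MeasurePreserving L μ μ := by
    refine ⟨L.continuous_of_finiteDimensional.measurable, ?_⟩
    rw [Measure.map_linearMap_addHaar_eq_smul_addHaar μ (left_ne_zero_of_mul_eq_one hdet), habs]
    simp
  exact (measurePreserving_add_left μ c).comp hpres

lemma setIntegral_comp_of_involutive {E : Type*} [MeasurableSpace E] {μ : Measure E} {σ : E → E}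
    (hσ : MeasurePreserving σ μ μ) (hi : Function.Involutive σ) {s : Set E} (hs : σ ⁻¹' s = s)
    (g : E → ℝ) : ∫ z in s, g (σ z) ∂μ = ∫ z in s, g z ∂μ := by
  have := hσ.setIntegral_preimage_emb
    (MeasurableEquiv.ofInvolutive σ hi hσ.measurable).measurableEmbedding g s
  rwa [hs] at this

lemma integrableOn_comp_of_involutive {E : Type*} [MeasurableSpace E] {μ : Measure E} {σ : E → E}
    (hσ : MeasurePreserving σ μ μ) (hi : Function.Involutive σ) {s : Set E} (hs : σ ⁻¹' s = s)
    {g : E → ℝ} (hg : IntegrableOn g s μ) : IntegrableOn (fun z => g (σ z)) s μ := by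
  have := (hσ.integrableOn_comp_preimage
    (MeasurableEquiv.ofInvolutive σ hi hσ.measurable).measurableEmbedding (f := g) (s := s)).2 hg
  rwa [hs] at this

instance isAddHaarMeasure_volume_prod_four :
    (volume : Measure (ℝ × ℝ × ℝ × ℝ)).IsAddHaarMeasure := by
  have h2 : (volume : Measure (ℝ × ℝ)).IsAddHaarMeasure :=
    Measure.prod.instIsAddHaarMeasure volume volume
  have h3 : (volume : Measure (ℝ × ℝ × ℝ)).IsAddHaarMeasure :=
    Measure.prod.instIsAddHaarMeasure volume volume
  exact Measure.prod.instIsAddHaarMeasure volume volume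

/-- The reflection exchanging the two loops, `1 ↔ 3` and `2 ↔ 4`. -/
def fiveLoopSwap (z : ℝ × ℝ × ℝ × ℝ) : ℝ × ℝ × ℝ × ℝ := (z.2.2.1, z.2.2.2, z.1, z.2.1)

/-- The reflection exchanging the two external vertices, `1 ↔ 2` and `3 ↔ 4`. -/
def fiveEndSwap (z : ℝ × ℝ × ℝ × ℝ) : ℝ × ℝ × ℝ × ℝ := (z.2.1, z.1, z.2.2.2, z.2.2.1)

/-- The exchange of the parameters `z₁` and `z₅`. -/
def fiveMidSwap (z : ℝ × ℝ × ℝ × ℝ) : ℝ × ℝ × ℝ × ℝ := (fiveZ5 z, z.2.1, z.2.2.1, z.2.2.2)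

lemma fiveLoopSwap_involutive : Function.Involutive fiveLoopSwap := fun _ => rfl

lemma fiveEndSwap_involutive : Function.Involutive fiveEndSwap := fun _ => rfl

lemma fiveMidSwap_involutive : Function.Involutive fiveMidSwap := fun z => by
  ext <;> simp [fiveMidSwap, fiveZ5]
  ring

lemma measurePreserving_fiveLoopSwap : MeasurePreserving fiveLoopSwap := by
  let L : (ℝ × ℝ × ℝ × ℝ) →ₗ[ℝ] ℝ × ℝ × ℝ × ℝ :=
    { toFun := fiveLoopSwap, map_add' := fun _ _ => rfl, map_smul' := fun _ _ => rfl }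
  have hL : (fun z => 0 + L z) = fiveLoopSwap := by ext1 z; exact zero_add _
  have := measurePreserving_of_involutive_affine volume L 0 (hL ▸ fiveLoopSwap_involutive)
  rwa [hL] at this

lemma measurePreserving_fiveEndSwap : MeasurePreserving fiveEndSwap := by
  let L : (ℝ × ℝ × ℝ × ℝ) →ₗ[ℝ] ℝ × ℝ × ℝ × ℝ :=
    { toFun := fiveEndSwap, map_add' := fun _ _ => rfl, map_smul' := fun _ _ => rfl }
  have hL : (fun z => 0 + L z) = fiveEndSwap := by ext1 z; exact zero_add _
  have := measurePreserving_of_involutive_affine volume L 0 (hL ▸ fiveEndSwap_involutive)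
  rwa [hL] at this

lemma measurePreserving_fiveMidSwap : MeasurePreserving fiveMidSwap := by
  let L : (ℝ × ℝ × ℝ × ℝ) →ₗ[ℝ] ℝ × ℝ × ℝ × ℝ :=
    { toFun := fun z => (-z.1 - z.2.1 - z.2.2.1 - z.2.2.2, z.2.1, z.2.2.1, z.2.2.2)
      map_add' := fun x y => by ext <;> simp; ring
      map_smul' := fun r x => by ext <;> simp; ring }
  have hL : (fun z => ((1, 0, 0, 0) : ℝ × ℝ × ℝ × ℝ) + L z) = fiveMidSwap := by
    ext z <;> simp [L, fiveMidSwap, fiveZ5]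
    ring
  have := measurePreserving_of_involutive_affine volume L (1, 0, 0, 0)
    (hL ▸ fiveMidSwap_involutive)
  rwa [hL] at this

lemma fiveLoopSwap_preimage : fiveLoopSwap ⁻¹' fiveT4 = fiveT4 := by
  ext z
  simp only [fiveLoopSwap, fiveT4, Set.mem_preimage, Set.mem_ofPred_eq]
  constructor <;> rintro ⟨h1, h2, h3, h4, h5⟩ <;> refine ⟨?_, ?_, ?_, ?_, ?_⟩ <;> linarith

lemma fiveEndSwap_preimage : fiveEndSwap ⁻¹' fiveT4 = fiveT4 := by
  ext z
  simp only [fiveEndSwap, fiveT4, Set.mem_preimage, Set.mem_ofPred_eq]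
  constructor <;> rintro ⟨h1, h2, h3, h4, h5⟩ <;> refine ⟨?_, ?_, ?_, ?_, ?_⟩ <;> linarith

lemma fiveMidSwap_preimage : fiveMidSwap ⁻¹' fiveT4 = fiveT4 := by
  ext z
  simp only [fiveMidSwap, fiveT4, fiveZ5, Set.mem_preimage, Set.mem_ofPred_eq]
  constructor <;> rintro ⟨h1, h2, h3, h4, h5⟩ <;> refine ⟨?_, ?_, ?_, ?_, ?_⟩ <;> linarith

lemma fiveZ5_loopSwap (z : ℝ × ℝ × ℝ × ℝ) : fiveZ5 (fiveLoopSwap z) = fiveZ5 z := by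
  simp only [fiveZ5, fiveLoopSwap]; ring

lemma fiveU_loopSwap (z : ℝ × ℝ × ℝ × ℝ) : fiveU (fiveLoopSwap z) = fiveU z := by
  simp only [fiveU, fiveZ5, fiveLoopSwap]; ring

lemma fiveC_loopSwap (z : ℝ × ℝ × ℝ × ℝ) : fiveC (fiveLoopSwap z) = fiveC z := by
  simp only [fiveC, fiveZ5, fiveLoopSwap]; ring

lemma fiveZ5_endSwap (z : ℝ × ℝ × ℝ × ℝ) : fiveZ5 (fiveEndSwap z) = fiveZ5 z := by
  simp only [fiveZ5, fiveEndSwap]; ring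

lemma fiveU_endSwap (z : ℝ × ℝ × ℝ × ℝ) : fiveU (fiveEndSwap z) = fiveU z := by
  simp only [fiveU, fiveZ5, fiveEndSwap]; ring

lemma fiveC_endSwap (z : ℝ × ℝ × ℝ × ℝ) : fiveC (fiveEndSwap z) = fiveC z := by
  simp only [fiveC, fiveZ5, fiveEndSwap]; ring

lemma measurable_fiveZ5 : Measurable fiveZ5 := by unfold fiveZ5; fun_prop

lemma measurable_fiveU : Measurable fiveU := by unfold fiveU fiveZ5; fun_prop

lemma measurable_fiveC : Measurable fiveC := by unfold fiveC fiveZ5; fun_prop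

lemma fiveU_pos_of_nonneg {z : ℝ × ℝ × ℝ × ℝ} (h1 : 0 < z.1) (h2 : 0 < z.2.1) (h3 : 0 < z.2.2.1)
    (h4 : 0 < z.2.2.2) (h5 : 0 ≤ fiveZ5 z) : 0 < fiveU z := by
  unfold fiveU; positivity

lemma fiveC_pos_of_nonneg {z : ℝ × ℝ × ℝ × ℝ} (h1 : 0 < z.1) (h2 : 0 < z.2.1) (h3 : 0 < z.2.2.1)
    (h4 : 0 < z.2.2.2) (h5 : 0 ≤ fiveZ5 z) : 0 < fiveC z := by
  unfold fiveC; positivity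

lemma rpow_mul_rpow_le_of_le_pow {ε U C P : ℝ} (hε : ε ∈ Set.Ioo (-(1 : ℝ) / 6) (1 / 6))
    (hU : 0 < U) (hC : 0 < C) (hP : 0 < P) (hPU : P ≤ (5 * U) ^ 3) (hPC : P ≤ (5 * C) ^ 2) :
    U ^ (3 * ε - 1) * C ^ (-(1 + 2 * ε)) ≤ 5 ^ (2 - ε) * P ^ (-(5 : ℝ) / 6) := by
  obtain ⟨h1, h2⟩ := hε
  have hU' : P ^ (1 / 3 : ℝ) ≤ 5 * U := by
    refine (Real.rpow_le_rpow hP.le hPU (by norm_num)).trans_eq ?_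
    rw [← Real.rpow_natCast, ← Real.rpow_mul (by positivity)]; norm_num
  have hC' : P ^ (1 / 2 : ℝ) ≤ 5 * C := by
    refine (Real.rpow_le_rpow hP.le hPC (by norm_num)).trans_eq ?_
    rw [← Real.rpow_natCast, ← Real.rpow_mul (by positivity)]; norm_num
  have hU2 := Real.rpow_le_rpow_of_nonpos (by positivity) hU' (z := 3 * ε - 1) (by linarith)
  have hC2 := Real.rpow_le_rpow_of_nonpos (by positivity) hC' (z := -(1 + 2 * ε)) (by linarith)
  rw [Real.mul_rpow (by norm_num) hU.le, ← Real.rpow_mul hP.le] at hU2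
  rw [Real.mul_rpow (by norm_num) hC.le, ← Real.rpow_mul hP.le] at hC2
  have key := mul_le_mul hU2 hC2 (by positivity) (by positivity)
  have h5 : (5 : ℝ) ^ (2 - ε) * (5 ^ (3 * ε - 1) * 5 ^ (-(1 + 2 * ε))) = 1 := by
    rw [← Real.rpow_add (by norm_num), ← Real.rpow_add (by norm_num)]
    ring_nf; simp
  rw [← Real.rpow_add hP] at key
  have he : 1 / 3 * (3 * ε - 1) + 1 / 2 * (-(1 + 2 * ε)) = -(5 : ℝ) / 6 := by ring
  rw [he] at key
  calc U ^ (3 * ε - 1) * C ^ (-(1 + 2 * ε))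
      = 5 ^ (2 - ε) * (5 ^ (3 * ε - 1) * U ^ (3 * ε - 1) *
          (5 ^ (-(1 + 2 * ε)) * C ^ (-(1 + 2 * ε)))) := by
        linear_combination (-(U ^ (3 * ε - 1) * C ^ (-(1 + 2 * ε)))) * h5
    _ ≤ _ := by gcongr

/-- Estimate in the sector where the rung parameter `z₅` is not small. -/
lemma fiveIntegrand_le_of_fiveZ5 {ε : ℝ} (hε : ε ∈ Set.Ioo (-(1 : ℝ) / 6) (1 / 6))
    {z : ℝ × ℝ × ℝ × ℝ} (hz : z ∈ fiveT4) (h : 1 / 5 ≤ fiveZ5 z) :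
    fiveU z ^ (3 * ε - 1) * fiveC z ^ (-(1 + 2 * ε)) ≤
      5 ^ (2 - ε) * (z.1 * z.2.1 * z.2.2.1 * z.2.2.2) ^ (-(5 : ℝ) / 6) := by
  have hU := fiveU_pos hz
  have hC := fiveC_pos hz
  obtain ⟨h1, h2, h3, h4, h5⟩ := hz
  refine rpow_mul_rpow_le_of_le_pow hε hU hC (by positivity) ?_ ?_
  · have hs : z.2.1 + z.2.2.1 + z.2.2.2 ≤ 5 * fiveU z := by
      unfold fiveU
      nlinarith [mul_pos (add_pos h1 h2) (add_pos h3 h4),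
        mul_nonneg (sub_nonneg.2 h) (add_pos (add_pos (add_pos h1 h2) h3) h4).le]
    calc z.1 * z.2.1 * z.2.2.1 * z.2.2.2 = z.1 * (z.2.1 * z.2.2.1 * z.2.2.2) := by ring
      _ ≤ 1 * ((z.2.1 + z.2.2.1 + z.2.2.2) * (z.2.1 + z.2.2.1 + z.2.2.2) *
            (z.2.1 + z.2.2.1 + z.2.2.2)) := by gcongr <;> linarith
      _ = (z.2.1 + z.2.2.1 + z.2.2.2) ^ 3 := by ring
      _ ≤ _ := by gcongr
  · have hs : (z.1 + z.2.2.1) * (z.2.1 + z.2.2.2) ≤ 5 * fiveC z := by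
      have : fiveZ5 z * ((z.1 + z.2.2.1) * (z.2.1 + z.2.2.2)) ≤ fiveC z := by
        unfold fiveC
        have : 0 ≤ z.1 * z.2.1 * z.2.2.1 + z.1 * z.2.1 * z.2.2.2 + z.1 * z.2.2.1 * z.2.2.2 +
          z.2.1 * z.2.2.1 * z.2.2.2 := by positivity
        linarith
      have h0 : 0 ≤ (z.1 + z.2.2.1) * (z.2.1 + z.2.2.2) := by positivity
      nlinarith
    calc z.1 * z.2.1 * z.2.2.1 * z.2.2.2 = (z.1 * z.2.1) * (z.2.2.1 * z.2.2.2) := by ring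
      _ ≤ ((z.1 + z.2.2.1) * (z.2.1 + z.2.2.2)) * ((z.1 + z.2.2.1) * (z.2.1 + z.2.2.2)) := by
        gcongr <;> linarith
      _ = ((z.1 + z.2.2.1) * (z.2.1 + z.2.2.2)) ^ 2 := by ring
      _ ≤ _ := by gcongr

/-- Estimate in the sector where the parameter `z₁` is not small. -/
lemma fiveIntegrand_le_of_fst {ε : ℝ} (hε : ε ∈ Set.Ioo (-(1 : ℝ) / 6) (1 / 6))
    {z : ℝ × ℝ × ℝ × ℝ} (hz : z ∈ fiveT4) (h : 1 / 5 ≤ z.1) :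
    fiveU z ^ (3 * ε - 1) * fiveC z ^ (-(1 + 2 * ε)) ≤
      5 ^ (2 - ε) * (fiveZ5 z * z.2.1 * z.2.2.1 * z.2.2.2) ^ (-(5 : ℝ) / 6) := by
  have hU := fiveU_pos hz
  have hC := fiveC_pos hz
  have h0 := fiveZ5_pos hz
  obtain ⟨h1, h2, h3, h4, h5⟩ := hz
  refine rpow_mul_rpow_le_of_le_pow hε hU hC (by positivity) ?_ ?_
  · have hs : fiveZ5 z + z.2.2.1 + z.2.2.2 ≤ 5 * fiveU z := by
      have : z.1 * (fiveZ5 z + z.2.2.1 + z.2.2.2) ≤ fiveU z := by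
        unfold fiveU
        have : 0 ≤ z.2.1 * (z.2.2.1 + z.2.2.2) + fiveZ5 z * (z.2.1 + z.2.2.1 + z.2.2.2) := by
          positivity
        linarith
      have : 0 ≤ fiveZ5 z + z.2.2.1 + z.2.2.2 := by positivity
      nlinarith
    calc fiveZ5 z * z.2.1 * z.2.2.1 * z.2.2.2 = z.2.1 * (fiveZ5 z * z.2.2.1 * z.2.2.2) := by ring
      _ ≤ 1 * ((fiveZ5 z + z.2.2.1 + z.2.2.2) * (fiveZ5 z + z.2.2.1 + z.2.2.2) *
            (fiveZ5 z + z.2.2.1 + z.2.2.2)) := by gcongr <;> linarith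
      _ = (fiveZ5 z + z.2.2.1 + z.2.2.2) ^ 3 := by ring
      _ ≤ _ := by gcongr
  · have hs : (fiveZ5 z + z.2.2.1) * (z.2.1 + z.2.2.2) ≤ 5 * fiveC z := by
      have : z.1 * ((fiveZ5 z + z.2.2.1) * (z.2.1 + z.2.2.2)) ≤ fiveC z := by
        unfold fiveC
        have : 0 ≤ z.1 * z.2.1 * z.2.2.2 + z.2.1 * z.2.2.1 * z.2.2.2 +
          z.2.1 * z.2.2.1 * fiveZ5 z + z.2.2.1 * z.2.2.2 * fiveZ5 z := by positivity
        linarith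
      have : 0 ≤ (fiveZ5 z + z.2.2.1) * (z.2.1 + z.2.2.2) := by positivity
      nlinarith
    calc fiveZ5 z * z.2.1 * z.2.2.1 * z.2.2.2 = (fiveZ5 z * z.2.1) * (z.2.2.1 * z.2.2.2) := by ring
      _ ≤ ((fiveZ5 z + z.2.2.1) * (z.2.1 + z.2.2.2)) *
          ((fiveZ5 z + z.2.2.1) * (z.2.1 + z.2.2.2)) := by
        gcongr <;> linarith
      _ = ((fiveZ5 z + z.2.2.1) * (z.2.1 + z.2.2.2)) ^ 2 := by ring
      _ ≤ _ := by gcongr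

lemma integrableOn_prod_rpow :
    IntegrableOn (fun z : ℝ × ℝ × ℝ × ℝ => (z.1 * z.2.1 * z.2.2.1 * z.2.2.2) ^ (-(5 : ℝ) / 6))
      fiveT4 := by
  have h : IntegrableOn (fun x : ℝ => x ^ (-(5 : ℝ) / 6)) (Set.Ioo 0 1) :=
    (intervalIntegral.integrableOn_Ioo_rpow_iff one_pos).2 (by norm_num)
  have h4 := Integrable.mul_prod h (Integrable.mul_prod h (Integrable.mul_prod h h))
  simp only [Measure.prod_restrict, ← Measure.volume_eq_prod] at h4
  refine (IntegrableOn.mono_set h4 ?_).congr_fun ?_ measurableSet_fiveT4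
  · rintro z ⟨h1, h2, h3, h4, h5⟩
    refine ⟨⟨h1, ?_⟩, ⟨h2, ?_⟩, ⟨h3, ?_⟩, h4, ?_⟩ <;> linarith
  · rintro z ⟨h1, h2, h3, h4, h5⟩
    dsimp only
    rw [Real.mul_rpow (by positivity) h4.le, Real.mul_rpow (by positivity) h3.le,
      Real.mul_rpow h1.le h2.le]
    ring

lemma integrableOn_fiveIntegrand {ε : ℝ} (hε : ε ∈ Set.Ioo (-(1 : ℝ) / 6) (1 / 6)) :
    IntegrableOn (fun z => fiveU z ^ (3 * ε - 1) * fiveC z ^ (-(1 + 2 * ε))) fiveT4 := by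
  have g5 := integrableOn_prod_rpow
  have g1 := integrableOn_comp_of_involutive measurePreserving_fiveMidSwap fiveMidSwap_involutive
    fiveMidSwap_preimage g5
  have g2 := integrableOn_comp_of_involutive measurePreserving_fiveEndSwap fiveEndSwap_involutive
    fiveEndSwap_preimage g1
  have g3 := integrableOn_comp_of_involutive measurePreserving_fiveLoopSwap
    fiveLoopSwap_involutive fiveLoopSwap_preimage g1
  have g4 := integrableOn_comp_of_involutive measurePreserving_fiveLoopSwap
    fiveLoopSwap_involutive fiveLoopSwap_preimage g2
  refine Integrable.mono' (((((g5.add g1).add g2).add g3).add g4).const_mul (5 ^ (2 - ε)))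
    ((measurable_fiveU.pow_const _).mul (measurable_fiveC.pow_const _)).aestronglyMeasurable ?_
  filter_upwards [ae_restrict_mem measurableSet_fiveT4] with z hz
  have hU := fiveU_pos hz
  have hC := fiveC_pos hz
  rw [Real.norm_of_nonneg (by positivity)]
  have hL : fiveLoopSwap z ∈ fiveT4 := by rwa [← Set.mem_preimage, fiveLoopSwap_preimage]
  have hE : fiveEndSwap z ∈ fiveT4 := by rwa [← Set.mem_preimage, fiveEndSwap_preimage]
  have hEL : fiveEndSwap (fiveLoopSwap z) ∈ fiveT4 := by
    rwa [← Set.mem_preimage, fiveEndSwap_preimage]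
  have e5 := fiveIntegrand_le_of_fiveZ5 hε hz
  have e1 := fiveIntegrand_le_of_fst hε hz
  have e2 := fiveIntegrand_le_of_fst hε hE
  have e3 := fiveIntegrand_le_of_fst hε hL
  have e4 := fiveIntegrand_le_of_fst hε hEL
  have p5 := fiveZ5_pos hz
  have h15 : fiveZ5 z = 1 - z.1 - z.2.1 - z.2.2.1 - z.2.2.2 := rfl
  simp only [fiveU_loopSwap, fiveC_loopSwap, fiveZ5_loopSwap, fiveU_endSwap, fiveC_endSwap,
    fiveZ5_endSwap] at e2 e3 e4
  simp only [Pi.add_apply, fiveMidSwap, fiveZ5_loopSwap, fiveZ5_endSwap]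
  simp only [fiveEndSwap, fiveLoopSwap] at *
  obtain ⟨h1, h2, h3, h4, h5⟩ := hz
  have q5 : 0 ≤ (5 : ℝ) ^ (2 - ε) * (z.1 * z.2.1 * z.2.2.1 * z.2.2.2) ^ (-(5 : ℝ) / 6) := by
    positivity
  have q1 : 0 ≤ (5 : ℝ) ^ (2 - ε) *
    (fiveZ5 z * z.2.1 * z.2.2.1 * z.2.2.2) ^ (-(5 : ℝ) / 6) := by positivity
  have q2 : 0 ≤ (5 : ℝ) ^ (2 - ε) *
    (fiveZ5 z * z.1 * z.2.2.2 * z.2.2.1) ^ (-(5 : ℝ) / 6) := by positivity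
  have q3 : 0 ≤ (5 : ℝ) ^ (2 - ε) *
    (fiveZ5 z * z.2.2.2 * z.1 * z.2.1) ^ (-(5 : ℝ) / 6) := by positivity
  have q4 : 0 ≤ (5 : ℝ) ^ (2 - ε) *
    (fiveZ5 z * z.2.2.1 * z.2.1 * z.1) ^ (-(5 : ℝ) / 6) := by positivity
  by_cases c5 : 1 / 5 ≤ fiveZ5 z
  · linarith [e5 c5]
  by_cases c1 : 1 / 5 ≤ z.1
  · linarith [e1 c1]
  by_cases c2 : 1 / 5 ≤ z.2.1
  · linarith [e2 c2]
  by_cases c3 : 1 / 5 ≤ z.2.2.1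
  · linarith [e3 c3]
  by_cases c4 : 1 / 5 ≤ z.2.2.2
  · linarith [e4 c4]
  · linarith

lemma integrableOn_mul_fiveU_rpow {ε : ℝ} (hε : ε ∈ Set.Ioo (-(1 : ℝ) / 6) (1 / 6))
    {m : ℝ × ℝ × ℝ × ℝ → ℝ} (hm : Measurable m) (h0 : ∀ z ∈ fiveT4, 0 ≤ m z)
    (hle : ∀ z ∈ fiveT4, m z ≤ fiveU z) :
    IntegrableOn (fun z => m z * fiveU z ^ (3 * ε - 2) * fiveC z ^ (-(1 + 2 * ε))) fiveT4 := by
  refine Integrable.mono' (integrableOn_fiveIntegrand hε) ((hm.mul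
    (measurable_fiveU.pow_const _)).mul (measurable_fiveC.pow_const _)).aestronglyMeasurable ?_
  filter_upwards [ae_restrict_mem measurableSet_fiveT4] with z hz
  have hU := fiveU_pos hz
  have hC := fiveC_pos hz
  have hm0 := h0 z hz
  rw [Real.norm_of_nonneg (by positivity),
    show 3 * ε - 1 = 1 + (3 * ε - 2) by ring, Real.rpow_add hU, Real.rpow_one]
  gcongr
  exact hle z hz

lemma integrableOn_mul_fiveC_rpow {ε : ℝ} (hε : ε ∈ Set.Ioo (-(1 : ℝ) / 6) (1 / 6))
    {m : ℝ × ℝ × ℝ × ℝ → ℝ} (hm : Measurable m) (h0 : ∀ z ∈ fiveT4, 0 ≤ m z)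
    (hle : ∀ z ∈ fiveT4, m z ≤ fiveC z) :
    IntegrableOn (fun z => m z * fiveU z ^ (3 * ε - 1) * fiveC z ^ (-(2 + 2 * ε))) fiveT4 := by
  refine Integrable.mono' (integrableOn_fiveIntegrand hε) ((hm.mul
    (measurable_fiveU.pow_const _)).mul (measurable_fiveC.pow_const _)).aestronglyMeasurable ?_
  filter_upwards [ae_restrict_mem measurableSet_fiveT4] with z hz
  have hU := fiveU_pos hz
  have hC := fiveC_pos hz
  have hm0 := h0 z hz
  rw [Real.norm_of_nonneg (by positivity),
    show -(1 + 2 * ε) = 1 + (-(2 + 2 * ε)) by ring, Real.rpow_add hC, Real.rpow_one,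
    mul_comm (m z), mul_assoc]
  gcongr
  exact hle z hz

lemma fiveZ5_smul (t : ℝ) (z : ℝ × ℝ × ℝ × ℝ) :
    fiveZ5 (t • z) = 1 - t * (z.1 + z.2.1 + z.2.2.1 + z.2.2.2) := by
  simp only [fiveZ5, Prod.smul_fst, Prod.smul_snd, smul_eq_mul]; ring

lemma hasDerivAt_fiveU_smul {t : ℝ} (ht : t ≠ 0) (z : ℝ × ℝ × ℝ × ℝ) :
    HasDerivAt (fun t : ℝ => fiveU (t • z))
      ((2 * fiveU (t • z) - t * (z.1 + z.2.1 + z.2.2.1 + z.2.2.2)) / t) t := by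
  have hU : ∀ t : ℝ, fiveU (t • z) = t ^ 2 * ((z.1 + z.2.1) * (z.2.2.1 + z.2.2.2)) +
      (t * (z.1 + z.2.1 + z.2.2.1 + z.2.2.2) -
        t ^ 2 * (z.1 + z.2.1 + z.2.2.1 + z.2.2.2) ^ 2) := fun t => by
    simp only [fiveU, fiveZ5, Prod.smul_fst, Prod.smul_snd, smul_eq_mul]; ring
  simp only [hU]
  have h2 := hasDerivAt_pow 2 t
  refine ((h2.mul_const _).add (((hasDerivAt_id t).mul_const _).sub
    (h2.mul_const _))).congr_deriv ?_
  field_simp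
  simp
  ring

lemma hasDerivAt_fiveC_smul (t : ℝ) (z : ℝ × ℝ × ℝ × ℝ) :
    HasDerivAt (fun t : ℝ => fiveC (t • z))
      ((3 * fiveC (t • z) - t ^ 2 * ((z.1 + z.2.2.1) * (z.2.1 + z.2.2.2))) / t) t := by
  have hC : ∀ t : ℝ, fiveC (t • z) = t ^ 3 * (z.1 * z.2.1 * z.2.2.1 + z.1 * z.2.1 * z.2.2.2 +
      z.1 * z.2.2.1 * z.2.2.2 + z.2.1 * z.2.2.1 * z.2.2.2 - (z.1 + z.2.1 + z.2.2.1 + z.2.2.2) *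
        ((z.1 + z.2.2.1) * (z.2.1 + z.2.2.2))) +
      t ^ 2 * ((z.1 + z.2.2.1) * (z.2.1 + z.2.2.2)) := fun t => by
    simp only [fiveC, fiveZ5, Prod.smul_fst, Prod.smul_snd, smul_eq_mul]; ring
  simp only [hC]
  refine (((hasDerivAt_pow 3 t).mul_const _).add
    ((hasDerivAt_pow 2 t).mul_const _)).congr_deriv ?_
  field_simp
  simp
  ring

/-- The radial derivative underlying the integration by parts in the direction `z₅ ∂/∂z₅`. -/
lemma hasDerivAt_fiveIntegrand_smul (ε : ℝ) {t : ℝ} (ht : t ≠ 0) {z : ℝ × ℝ × ℝ × ℝ}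
    (hU : 0 < fiveU (t • z)) (hC : 0 < fiveC (t • z)) :
    HasDerivAt (fun t : ℝ => t ^ 4 * (fiveZ5 (t • z) *
        (fiveU (t • z) ^ (3 * ε - 1) * fiveC (t • z) ^ (-(1 + 2 * ε)))))
      (t ^ 4 * t⁻¹ * -(fiveU (t • z) ^ (3 * ε - 1) * fiveC (t • z) ^ (-(1 + 2 * ε)) -
        (1 - 3 * ε) * (fiveZ5 (t • z) * (t * (z.1 + z.2.1 + z.2.2.1 + z.2.2.2)) *
          fiveU (t • z) ^ (3 * ε - 2) * fiveC (t • z) ^ (-(1 + 2 * ε))) -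
        (1 + 2 * ε) * (fiveZ5 (t • z) * (t ^ 2 * ((z.1 + z.2.2.1) * (z.2.1 + z.2.2.2))) *
          fiveU (t • z) ^ (3 * ε - 1) * fiveC (t • z) ^ (-(2 + 2 * ε))))) t := by
  have dU := (hasDerivAt_fiveU_smul ht z).rpow_const (p := 3 * ε - 1) (Or.inl hU.ne')
  have dC := (hasDerivAt_fiveC_smul t z).rpow_const (p := -(1 + 2 * ε)) (Or.inl hC.ne')
  have dZ : HasDerivAt (fun t : ℝ => fiveZ5 (t • z)) (-(z.1 + z.2.1 + z.2.2.1 + z.2.2.2)) t := by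
    simp only [fiveZ5_smul]
    simpa using ((hasDerivAt_id t).mul_const (z.1 + z.2.1 + z.2.2.1 + z.2.2.2)).const_sub 1
  refine ((hasDerivAt_pow 4 t).mul (dZ.mul (dU.mul dC))).congr_deriv ?_
  have eU : fiveU (t • z) ^ (3 * ε - 1) = fiveU (t • z) * fiveU (t • z) ^ (3 * ε - 2) := by
    rw [show 3 * ε - 1 = 1 + (3 * ε - 2) by ring, Real.rpow_add hU, Real.rpow_one]
  have eC : fiveC (t • z) ^ (-(1 + 2 * ε)) = fiveC (t • z) * fiveC (t • z) ^ (-(2 + 2 * ε)) := by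
    rw [show -(1 + 2 * ε) = 1 + (-(2 + 2 * ε)) by ring, Real.rpow_add hC, Real.rpow_one]
  simp only [Pi.mul_apply, Nat.cast_ofNat, Nat.add_one_sub_one]
  rw [show 3 * ε - 1 - 1 = 3 * ε - 2 by ring, show -(1 + 2 * ε) - 1 = -(2 + 2 * ε) by ring, eU, eC,
    fiveZ5_smul]
  generalize fiveU (t • z) ^ (3 * ε - 2) = a
  generalize fiveC (t • z) ^ (-(2 + 2 * ε)) = b
  generalize fiveU (t • z) = u
  generalize fiveC (t • z) = c
  generalize z.1 + z.2.1 + z.2.2.1 + z.2.2.2 = s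
  generalize (z.1 + z.2.2.1) * (z.2.1 + z.2.2.2) = d
  field_simp
  ring

lemma mem_fiveT4_smul_iff {t : ℝ} (ht : 0 < t) {z : ℝ × ℝ × ℝ × ℝ} (h1 : 0 < z.1) (h2 : 0 < z.2.1)
    (h3 : 0 < z.2.2.1) (h4 : 0 < z.2.2.2) : t • z ∈ fiveT4 ↔ 0 < fiveZ5 (t • z) := by
  refine ⟨fiveZ5_pos, fun h => ⟨?_, ?_, ?_, ?_, ?_⟩⟩
  · exact mul_pos ht h1
  · exact mul_pos ht h2
  · exact mul_pos ht h3
  · exact mul_pos ht h4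
  · unfold fiveZ5 at h; linarith

lemma smul_notMem_fiveT4 {t : ℝ} (ht : 0 < t) {z : ℝ × ℝ × ℝ × ℝ}
    (h : ¬(0 < z.1 ∧ 0 < z.2.1 ∧ 0 < z.2.2.1 ∧ 0 < z.2.2.2)) : t • z ∉ fiveT4 := fun hz =>
  h ⟨pos_of_mul_pos_right hz.1 ht.le, pos_of_mul_pos_right hz.2.1 ht.le,
    pos_of_mul_pos_right hz.2.2.1 ht.le, pos_of_mul_pos_right hz.2.2.2.1 ht.le⟩

/-- Integration by parts in the direction `z₅ ∂/∂z₅`. -/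
lemma setIntegral_fiveZ5_ibp {ε : ℝ} (hε : ε ∈ Set.Ioo (-(1 : ℝ) / 6) (1 / 6)) :
    ∫ z in fiveT4, (fiveU z ^ (3 * ε - 1) * fiveC z ^ (-(1 + 2 * ε)) -
        (1 - 3 * ε) * (fiveZ5 z * (z.1 + z.2.1 + z.2.2.1 + z.2.2.2) *
          fiveU z ^ (3 * ε - 2) * fiveC z ^ (-(1 + 2 * ε))) -
        (1 + 2 * ε) * (fiveZ5 z * ((z.1 + z.2.2.1) * (z.2.1 + z.2.2.2)) *
          fiveU z ^ (3 * ε - 1) * fiveC z ^ (-(2 + 2 * ε)))) = 0 := by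
  have mU := measurable_fiveU
  have mC := measurable_fiveC
  have mZ := measurable_fiveZ5
  have mT := measurableSet_fiveT4
  have hf := integrableOn_fiveIntegrand hε
  set h : ℝ × ℝ × ℝ × ℝ → ℝ := fiveT4.indicator fun z =>
    fiveZ5 z * (fiveU z ^ (3 * ε - 1) * fiveC z ^ (-(1 + 2 * ε))) with hh
  set k : ℝ × ℝ × ℝ × ℝ → ℝ := fiveT4.indicator fun z =>
    -(fiveU z ^ (3 * ε - 1) * fiveC z ^ (-(1 + 2 * ε)) -
        (1 - 3 * ε) * (fiveZ5 z * (z.1 + z.2.1 + z.2.2.1 + z.2.2.2) *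
          fiveU z ^ (3 * ε - 2) * fiveC z ^ (-(1 + 2 * ε))) -
        (1 + 2 * ε) * (fiveZ5 z * ((z.1 + z.2.2.1) * (z.2.1 + z.2.2.2)) *
          fiveU z ^ (3 * ε - 1) * fiveC z ^ (-(2 + 2 * ε)))) with hk
  have hrank : Module.finrank ℝ (ℝ × ℝ × ℝ × ℝ) = 4 := by simp
  have ih : Integrable h := by
    rw [hh, integrable_indicator_iff mT]
    refine Integrable.mono' hf (by fun_prop) ?_
    filter_upwards [ae_restrict_mem mT] with z hz
    have hU := fiveU_pos hz
    have hC := fiveC_pos hz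
    have hZ := fiveZ5_pos hz
    rw [Real.norm_of_nonneg (by positivity)]
    refine mul_le_of_le_one_left (by positivity) ?_
    obtain ⟨h1, h2, h3, h4, h5⟩ := hz
    unfold fiveZ5
    linarith
  have ik : Integrable k := by
    rw [hk, integrable_indicator_iff mT]
    refine ((hf.sub ((integrableOn_mul_fiveU_rpow hε (by fun_prop) ?_ ?_).const_mul _)).sub
      ((integrableOn_mul_fiveC_rpow hε (by fun_prop) ?_ ?_).const_mul _)).neg <;>
    intro z hz <;> have hZ := fiveZ5_pos hz <;> obtain ⟨h1, h2, h3, h4, h5⟩ := hz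
    · positivity
    · unfold fiveU
      linarith [mul_pos (add_pos h1 h2) (add_pos h3 h4)]
    · positivity
    · unfold fiveC
      have : 0 ≤ z.1 * z.2.1 * z.2.2.1 + z.1 * z.2.1 * z.2.2.2 + z.1 * z.2.2.1 * z.2.2.2 +
          z.2.1 * z.2.2.1 * z.2.2.2 := by positivity
      linarith
  have mk : Measurable k := by
    refine Measurable.indicator ?_ mT
    fun_prop
  have hcont : Continuous fiveZ5 := by unfold fiveZ5; fun_prop
  have hzero : ∫ z, k z = 0 := by
    refine integral_eq_zero_of_hasDerivAt_smul volume ih ik mk ?_ ?_ <;> intro z <;> rw [hrank]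
    · by_cases hz : 0 < z.1 ∧ 0 < z.2.1 ∧ 0 < z.2.2.1 ∧ 0 < z.2.2.2
      · obtain ⟨h1, h2, h3, h4⟩ := hz
        have heq : ∀ t ∈ Set.Icc (1 : ℝ) 2, t ^ 4 * h (t • z) = t ^ 4 * (max (fiveZ5 (t • z)) 0 *
            (fiveU (t • z) ^ (3 * ε - 1) * fiveC (t • z) ^ (-(1 + 2 * ε)))) := by
          intro t ht
          have ht0 : 0 < t := zero_lt_one.trans_le ht.1
          by_cases hT : t • z ∈ fiveT4
          · rw [hh, Set.indicator_of_mem hT, max_eq_left (fiveZ5_pos hT).le]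
          · rw [hh, Set.indicator_of_notMem hT, max_eq_right, zero_mul]
            rwa [mem_fiveT4_smul_iff ht0 h1 h2 h3 h4, not_lt] at hT
        refine ContinuousOn.congr (fun t ht => ContinuousAt.continuousWithinAt ?_) heq
        have ht0 : 0 < t := zero_lt_one.trans_le ht.1
        have hZc : Continuous fun t : ℝ => fiveZ5 (t • z) := hcont.comp (by fun_prop)
        rcases lt_or_ge (fiveZ5 (t • z)) 0 with hneg | hnn
        · have : (fun t : ℝ => t ^ 4 * (max (fiveZ5 (t • z)) 0 *
              (fiveU (t • z) ^ (3 * ε - 1) * fiveC (t • z) ^ (-(1 + 2 * ε)))))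
              =ᶠ[nhds t] fun _ => 0 := by
            filter_upwards [hZc.continuousAt.eventually_lt_const hneg] with x hx
            rw [max_eq_right hx.le]; ring
          exact continuousAt_const.congr this.symm
        · have hU : 0 < fiveU (t • z) := fiveU_pos_of_nonneg (mul_pos ht0 h1) (mul_pos ht0 h2)
            (mul_pos ht0 h3) (mul_pos ht0 h4) hnn
          have hC : 0 < fiveC (t • z) := fiveC_pos_of_nonneg (mul_pos ht0 h1) (mul_pos ht0 h2)
            (mul_pos ht0 h3) (mul_pos ht0 h4) hnn
          have cU := (hasDerivAt_fiveU_smul ht0.ne' z).continuousAt.rpow_const (p := 3 * ε - 1)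
            (Or.inl hU.ne')
          have cC := (hasDerivAt_fiveC_smul t z).continuousAt.rpow_const
            (p := -(1 + 2 * ε)) (Or.inl hC.ne')
          exact (continuousAt_id.pow 4).mul
            ((hZc.max continuous_const).continuousAt.mul (cU.mul cC))
      · refine (continuousOn_const (c := (0 : ℝ))).congr fun t ht => ?_
        rw [hh, Set.indicator_of_notMem (smul_notMem_fiveT4 (zero_lt_one.trans_le ht.1) hz),
          mul_zero]
    · refine ⟨{(z.1 + z.2.1 + z.2.2.1 + z.2.2.2)⁻¹}, Set.countable_singleton _, ?_⟩
      rintro t ⟨ht, hts⟩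
      have ht0 : 0 < t := zero_lt_one.trans ht.1
      by_cases hT : t • z ∈ fiveT4
      · have hev : ∀ᶠ x : ℝ in nhds t, x • z ∈ fiveT4 := by
          have hopen : IsOpen fiveT4 := by
            unfold fiveT4
            refine IsOpen.and ?_ (IsOpen.and ?_ (IsOpen.and ?_ (IsOpen.and ?_ ?_))) <;>
            exact isOpen_lt (by fun_prop) (by fun_prop)
          have hc : ContinuousAt (fun x : ℝ => x • z) t := by fun_prop
          exact hc.eventually (hopen.mem_nhds hT)
        have hd := hasDerivAt_fiveIntegrand_smul ε ht0.ne' (fiveU_pos hT) (fiveC_pos hT)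
        refine (hd.congr_of_eventuallyEq ?_).congr_deriv ?_
        · filter_upwards [hev] with x hx
          rw [hh, Set.indicator_of_mem hx]
        · rw [hk, Set.indicator_of_mem hT]
          simp only [Prod.smul_fst, Prod.smul_snd, smul_eq_mul]
          ring
      · rw [hk, Set.indicator_of_notMem hT, mul_zero]
        have hev : ∀ᶠ x : ℝ in nhds t, x • z ∉ fiveT4 := by
          by_cases hz : 0 < z.1 ∧ 0 < z.2.1 ∧ 0 < z.2.2.1 ∧ 0 < z.2.2.2
          · obtain ⟨h1, h2, h3, h4⟩ := hz
            have hs : 0 < z.1 + z.2.1 + z.2.2.1 + z.2.2.2 := by positivity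
            have hneg : fiveZ5 (t • z) < 0 := by
              rw [mem_fiveT4_smul_iff ht0 h1 h2 h3 h4, not_lt] at hT
              refine hT.lt_of_ne fun h0 => hts ?_
              rw [fiveZ5_smul] at h0
              exact eq_inv_of_mul_eq_one_left (by linarith)
            have hZc : Continuous fun t : ℝ => fiveZ5 (t • z) := hcont.comp (by fun_prop)
            filter_upwards [hZc.continuousAt.eventually_lt_const hneg] with x hx hxT
            exact hx.not_gt (fiveZ5_pos hxT)
          · filter_upwards [lt_mem_nhds ht0] with x hx
            exact smul_notMem_fiveT4 hx hz
        refine (hasDerivAt_const t (0 : ℝ)).congr_of_eventuallyEq ?_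
        filter_upwards [hev] with x hx
        rw [hh, Set.indicator_of_notMem hx, mul_zero]
  rw [hk, integral_indicator mT, integral_neg, neg_eq_zero] at hzero
  exact hzero

lemma integral_add_four {E : Type*} [MeasurableSpace E] {μ : Measure E} {a b c d : E → ℝ}
    (ha : Integrable a μ) (hb : Integrable b μ) (hc : Integrable c μ) (hd : Integrable d μ) :
    ∫ z, (a z + b z + c z + d z) ∂μ =
      (∫ z, a z ∂μ) + (∫ z, b z ∂μ) + (∫ z, c z ∂μ) + ∫ z, d z ∂μ := by
  have h1 := integral_add ((ha.add hb).add hc) hd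
  have h2 := integral_add (ha.add hb) hc
  simp only [Pi.add_apply] at h1 h2
  rw [h1, h2, integral_add ha hb]

/-- Two-loop parameter-space IBP identity (vanishing boundary term) for the
five-edge two-point diagram:
`I(1,1,1,1,1;−1+3ε) − (1−3ε)[I(1,2,2,1,1;−2+3ε) + I(1,2,1,2,1;−2+3ε) + I(1,1,2,1,2;−2+3ε)]
  = (1+2ε)[2 I(1,2,2,2,1;−1+3ε) + I(2,2,1,2,1;−1+3ε) + I(1,2,2,1,2;−1+3ε)
      + I(1,1,2,2,2;−1+3ε)]`. -/
theorem five_edge_ibp_b (ε : ℝ) (hε : ε ∈ Set.Ioo (-(1 : ℝ) / 6) (1 / 6)) :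
    IntegrableOn (fun z => fiveU z ^ (3 * ε - 1) * fiveC z ^ (-(1 + 2 * ε))) fiveT4 volume ∧
    IntegrableOn (fun z => z.2.1 * z.2.2.1 * fiveU z ^ (3 * ε - 2) * fiveC z ^ (-(1 + 2 * ε)))
      fiveT4 volume ∧
    IntegrableOn (fun z => z.2.1 * z.2.2.2 * fiveU z ^ (3 * ε - 2) * fiveC z ^ (-(1 + 2 * ε)))
      fiveT4 volume ∧
    IntegrableOn (fun z => z.2.2.1 * fiveZ5 z * fiveU z ^ (3 * ε - 2) * fiveC z ^ (-(1 + 2 * ε)))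
      fiveT4 volume ∧
    IntegrableOn
      (fun z => z.2.1 * z.2.2.1 * z.2.2.2 * fiveU z ^ (3 * ε - 1) * fiveC z ^ (-(2 + 2 * ε)))
      fiveT4 volume ∧
    IntegrableOn
      (fun z => z.1 * z.2.1 * z.2.2.2 * fiveU z ^ (3 * ε - 1) * fiveC z ^ (-(2 + 2 * ε)))
      fiveT4 volume ∧
    IntegrableOn
      (fun z => z.2.1 * z.2.2.1 * fiveZ5 z * fiveU z ^ (3 * ε - 1) * fiveC z ^ (-(2 + 2 * ε)))
      fiveT4 volume ∧
    IntegrableOn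
      (fun z => z.2.2.1 * z.2.2.2 * fiveZ5 z * fiveU z ^ (3 * ε - 1) * fiveC z ^ (-(2 + 2 * ε)))
      fiveT4 volume ∧
    (∫ z in fiveT4, fiveU z ^ (3 * ε - 1) * fiveC z ^ (-(1 + 2 * ε)))
        - (1 - 3 * ε) *
          ((∫ z in fiveT4, z.2.1 * z.2.2.1 * fiveU z ^ (3 * ε - 2) * fiveC z ^ (-(1 + 2 * ε)))
            + (∫ z in fiveT4, z.2.1 * z.2.2.2 * fiveU z ^ (3 * ε - 2) * fiveC z ^ (-(1 + 2 * ε)))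
            + ∫ z in fiveT4, z.2.2.1 * fiveZ5 z * fiveU z ^ (3 * ε - 2) * fiveC z ^ (-(1 + 2 * ε)))
      = (1 + 2 * ε) *
          (2 * (∫ z in fiveT4,
              z.2.1 * z.2.2.1 * z.2.2.2 * fiveU z ^ (3 * ε - 1) * fiveC z ^ (-(2 + 2 * ε)))
            + (∫ z in fiveT4,
              z.1 * z.2.1 * z.2.2.2 * fiveU z ^ (3 * ε - 1) * fiveC z ^ (-(2 + 2 * ε)))
            + (∫ z in fiveT4,
              z.2.1 * z.2.2.1 * fiveZ5 z * fiveU z ^ (3 * ε - 1) * fiveC z ^ (-(2 + 2 * ε)))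
            + ∫ z in fiveT4,
              z.2.2.1 * z.2.2.2 * fiveZ5 z * fiveU z ^ (3 * ε - 1) * fiveC z ^ (-(2 + 2 * ε))) := by
  have mZ := measurable_fiveZ5
  have hf := integrableOn_fiveIntegrand hε
  let A : (ℝ × ℝ × ℝ × ℝ → ℝ) → ℝ × ℝ × ℝ × ℝ → ℝ := fun m z =>
    m z * fiveU z ^ (3 * ε - 2) * fiveC z ^ (-(1 + 2 * ε))
  let B : (ℝ × ℝ × ℝ × ℝ → ℝ) → ℝ × ℝ × ℝ × ℝ → ℝ := fun m z =>
    m z * fiveU z ^ (3 * ε - 1) * fiveC z ^ (-(2 + 2 * ε))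
  have i13 : IntegrableOn (A fun z => z.1 * z.2.2.1) fiveT4 := by
    refine integrableOn_mul_fiveU_rpow hε (by fun_prop) ?_ ?_ <;> intro z hz <;>
      have hZ := fiveZ5_pos hz <;> obtain ⟨h1, h2, h3, h4, -⟩ := hz
    · positivity
    · rw [← sub_nonneg]; unfold fiveU; ring_nf; positivity
  have i14 : IntegrableOn (A fun z => z.1 * z.2.2.2) fiveT4 := by
    refine integrableOn_mul_fiveU_rpow hε (by fun_prop) ?_ ?_ <;> intro z hz <;>
      have hZ := fiveZ5_pos hz <;> obtain ⟨h1, h2, h3, h4, -⟩ := hz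
    · positivity
    · rw [← sub_nonneg]; unfold fiveU; ring_nf; positivity
  have i23 : IntegrableOn (A fun z => z.2.1 * z.2.2.1) fiveT4 := by
    refine integrableOn_mul_fiveU_rpow hε (by fun_prop) ?_ ?_ <;> intro z hz <;>
      have hZ := fiveZ5_pos hz <;> obtain ⟨h1, h2, h3, h4, -⟩ := hz
    · positivity
    · rw [← sub_nonneg]; unfold fiveU; ring_nf; positivity
  have i24 : IntegrableOn (A fun z => z.2.1 * z.2.2.2) fiveT4 := by
    refine integrableOn_mul_fiveU_rpow hε (by fun_prop) ?_ ?_ <;> intro z hz <;>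
      have hZ := fiveZ5_pos hz <;> obtain ⟨h1, h2, h3, h4, -⟩ := hz
    · positivity
    · rw [← sub_nonneg]; unfold fiveU; ring_nf; positivity
  have i15 : IntegrableOn (A fun z => z.1 * fiveZ5 z) fiveT4 := by
    refine integrableOn_mul_fiveU_rpow hε (by fun_prop) ?_ ?_ <;> intro z hz <;>
      have hZ := fiveZ5_pos hz <;> obtain ⟨h1, h2, h3, h4, -⟩ := hz
    · positivity
    · rw [← sub_nonneg]; unfold fiveU; ring_nf; positivity
  have i25 : IntegrableOn (A fun z => z.2.1 * fiveZ5 z) fiveT4 := by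
    refine integrableOn_mul_fiveU_rpow hε (by fun_prop) ?_ ?_ <;> intro z hz <;>
      have hZ := fiveZ5_pos hz <;> obtain ⟨h1, h2, h3, h4, -⟩ := hz
    · positivity
    · rw [← sub_nonneg]; unfold fiveU; ring_nf; positivity
  have i35 : IntegrableOn (A fun z => z.2.2.1 * fiveZ5 z) fiveT4 := by
    refine integrableOn_mul_fiveU_rpow hε (by fun_prop) ?_ ?_ <;> intro z hz <;>
      have hZ := fiveZ5_pos hz <;> obtain ⟨h1, h2, h3, h4, -⟩ := hz
    · positivity
    · rw [← sub_nonneg]; unfold fiveU; ring_nf; positivity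
  have i45 : IntegrableOn (A fun z => z.2.2.2 * fiveZ5 z) fiveT4 := by
    refine integrableOn_mul_fiveU_rpow hε (by fun_prop) ?_ ?_ <;> intro z hz <;>
      have hZ := fiveZ5_pos hz <;> obtain ⟨h1, h2, h3, h4, -⟩ := hz
    · positivity
    · rw [← sub_nonneg]; unfold fiveU; ring_nf; positivity
  have i123 : IntegrableOn (B fun z => z.1 * z.2.1 * z.2.2.1) fiveT4 := by
    refine integrableOn_mul_fiveC_rpow hε (by fun_prop) ?_ ?_ <;> intro z hz <;>
      have hZ := fiveZ5_pos hz <;> obtain ⟨h1, h2, h3, h4, -⟩ := hz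
    · positivity
    · rw [← sub_nonneg]; unfold fiveC; ring_nf; positivity
  have i124 : IntegrableOn (B fun z => z.1 * z.2.1 * z.2.2.2) fiveT4 := by
    refine integrableOn_mul_fiveC_rpow hε (by fun_prop) ?_ ?_ <;> intro z hz <;>
      have hZ := fiveZ5_pos hz <;> obtain ⟨h1, h2, h3, h4, -⟩ := hz
    · positivity
    · rw [← sub_nonneg]; unfold fiveC; ring_nf; positivity
  have i134 : IntegrableOn (B fun z => z.1 * z.2.2.1 * z.2.2.2) fiveT4 := by
    refine integrableOn_mul_fiveC_rpow hε (by fun_prop) ?_ ?_ <;> intro z hz <;>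
      have hZ := fiveZ5_pos hz <;> obtain ⟨h1, h2, h3, h4, -⟩ := hz
    · positivity
    · rw [← sub_nonneg]; unfold fiveC; ring_nf; positivity
  have i234 : IntegrableOn (B fun z => z.2.1 * z.2.2.1 * z.2.2.2) fiveT4 := by
    refine integrableOn_mul_fiveC_rpow hε (by fun_prop) ?_ ?_ <;> intro z hz <;>
      have hZ := fiveZ5_pos hz <;> obtain ⟨h1, h2, h3, h4, -⟩ := hz
    · positivity
    · rw [← sub_nonneg]; unfold fiveC; ring_nf; positivity
  have i125 : IntegrableOn (B fun z => z.1 * z.2.1 * fiveZ5 z) fiveT4 := by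
    refine integrableOn_mul_fiveC_rpow hε (by fun_prop) ?_ ?_ <;> intro z hz <;>
      have hZ := fiveZ5_pos hz <;> obtain ⟨h1, h2, h3, h4, -⟩ := hz
    · positivity
    · rw [← sub_nonneg]; unfold fiveC; ring_nf; positivity
  have i145 : IntegrableOn (B fun z => z.1 * z.2.2.2 * fiveZ5 z) fiveT4 := by
    refine integrableOn_mul_fiveC_rpow hε (by fun_prop) ?_ ?_ <;> intro z hz <;>
      have hZ := fiveZ5_pos hz <;> obtain ⟨h1, h2, h3, h4, -⟩ := hz
    · positivity
    · rw [← sub_nonneg]; unfold fiveC; ring_nf; positivity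
  have i235 : IntegrableOn (B fun z => z.2.1 * z.2.2.1 * fiveZ5 z) fiveT4 := by
    refine integrableOn_mul_fiveC_rpow hε (by fun_prop) ?_ ?_ <;> intro z hz <;>
      have hZ := fiveZ5_pos hz <;> obtain ⟨h1, h2, h3, h4, -⟩ := hz
    · positivity
    · rw [← sub_nonneg]; unfold fiveC; ring_nf; positivity
  have i345 : IntegrableOn (B fun z => z.2.2.1 * z.2.2.2 * fiveZ5 z) fiveT4 := by
    refine integrableOn_mul_fiveC_rpow hε (by fun_prop) ?_ ?_ <;> intro z hz <;>
      have hZ := fiveZ5_pos hz <;> obtain ⟨h1, h2, h3, h4, -⟩ := hz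
    · positivity
    · rw [← sub_nonneg]; unfold fiveC; ring_nf; positivity
  have loop := setIntegral_comp_of_involutive measurePreserving_fiveLoopSwap
    fiveLoopSwap_involutive fiveLoopSwap_preimage
  have ends := setIntegral_comp_of_involutive measurePreserving_fiveEndSwap
    fiveEndSwap_involutive fiveEndSwap_preimage
  have s13 : ∫ z in fiveT4, A (fun z => z.1 * z.2.2.1) z =
      ∫ z in fiveT4, A (fun z => z.2.1 * z.2.2.2) z := by
    rw [← ends]
    refine integral_congr_ae (.of_forall fun z => ?_)
    simp only [A, fiveU_endSwap, fiveC_endSwap]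
    simp only [fiveEndSwap]
  have s14 : ∫ z in fiveT4, A (fun z => z.1 * z.2.2.2) z =
      ∫ z in fiveT4, A (fun z => z.2.1 * z.2.2.1) z := by
    rw [← ends]
    refine integral_congr_ae (.of_forall fun z => ?_)
    simp only [A, fiveU_endSwap, fiveC_endSwap]
    simp only [fiveEndSwap]
  have s15 : ∫ z in fiveT4, A (fun z => z.1 * fiveZ5 z) z =
      ∫ z in fiveT4, A (fun z => z.2.2.1 * fiveZ5 z) z := by
    rw [← loop]
    refine integral_congr_ae (.of_forall fun z => ?_)
    simp only [A, fiveU_loopSwap, fiveC_loopSwap, fiveZ5_loopSwap]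
    simp only [fiveLoopSwap]
  have s25 : ∫ z in fiveT4, A (fun z => z.2.1 * fiveZ5 z) z =
      ∫ z in fiveT4, A (fun z => z.2.2.2 * fiveZ5 z) z := by
    rw [← loop]
    refine integral_congr_ae (.of_forall fun z => ?_)
    simp only [A, fiveU_loopSwap, fiveC_loopSwap, fiveZ5_loopSwap]
    simp only [fiveLoopSwap]
  have s45 : ∫ z in fiveT4, A (fun z => z.2.2.2 * fiveZ5 z) z =
      ∫ z in fiveT4, A (fun z => z.2.2.1 * fiveZ5 z) z := by
    rw [← ends]
    refine integral_congr_ae (.of_forall fun z => ?_)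
    simp only [A, fiveU_endSwap, fiveC_endSwap, fiveZ5_endSwap]
    simp only [fiveEndSwap]
  have s124 : ∫ z in fiveT4, B (fun z => z.1 * z.2.1 * z.2.2.2) z =
      ∫ z in fiveT4, B (fun z => z.2.1 * z.2.2.1 * z.2.2.2) z := by
    rw [← loop]
    refine integral_congr_ae (.of_forall fun z => ?_)
    simp only [B, fiveU_loopSwap, fiveC_loopSwap]
    simp only [fiveLoopSwap]
    ring
  have s123 : ∫ z in fiveT4, B (fun z => z.1 * z.2.1 * z.2.2.1) z =
      ∫ z in fiveT4, B (fun z => z.1 * z.2.1 * z.2.2.2) z := by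
    rw [← ends]
    refine integral_congr_ae (.of_forall fun z => ?_)
    simp only [B, fiveU_endSwap, fiveC_endSwap]
    simp only [fiveEndSwap]
    ring
  have s134 : ∫ z in fiveT4, B (fun z => z.1 * z.2.2.1 * z.2.2.2) z =
      ∫ z in fiveT4, B (fun z => z.1 * z.2.1 * z.2.2.1) z := by
    rw [← loop]
    refine integral_congr_ae (.of_forall fun z => ?_)
    simp only [B, fiveU_loopSwap, fiveC_loopSwap]
    simp only [fiveLoopSwap]
    ring
  have s125 : ∫ z in fiveT4, B (fun z => z.1 * z.2.1 * fiveZ5 z) z =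
      ∫ z in fiveT4, B (fun z => z.2.2.1 * z.2.2.2 * fiveZ5 z) z := by
    rw [← loop]
    refine integral_congr_ae (.of_forall fun z => ?_)
    simp only [B, fiveU_loopSwap, fiveC_loopSwap, fiveZ5_loopSwap]
    simp only [fiveLoopSwap]
  have s145 : ∫ z in fiveT4, B (fun z => z.1 * z.2.2.2 * fiveZ5 z) z =
      ∫ z in fiveT4, B (fun z => z.2.1 * z.2.2.1 * fiveZ5 z) z := by
    rw [← loop]
    refine integral_congr_ae (.of_forall fun z => ?_)
    simp only [B, fiveU_loopSwap, fiveC_loopSwap, fiveZ5_loopSwap]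
    simp only [fiveLoopSwap]
    ring
  have hAZ := integral_add_four i15 i25 i35 i45
  have hAL := integral_add_four i13 i14 i23 i24
  have hBZ := integral_add_four i125 i145 i235 i345
  have hBL := integral_add_four i123 i124 i134 i234
  have expandU : ∫ z in fiveT4, fiveU z ^ (3 * ε - 1) * fiveC z ^ (-(1 + 2 * ε)) =
      (∫ z in fiveT4, (A (fun z => z.1 * z.2.2.1) z + A (fun z => z.1 * z.2.2.2) z +
        A (fun z => z.2.1 * z.2.2.1) z + A (fun z => z.2.1 * z.2.2.2) z)) +
      ∫ z in fiveT4, (A (fun z => z.1 * fiveZ5 z) z + A (fun z => z.2.1 * fiveZ5 z) z +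
        A (fun z => z.2.2.1 * fiveZ5 z) z + A (fun z => z.2.2.2 * fiveZ5 z) z) := by
    refine Eq.trans (setIntegral_congr_fun measurableSet_fiveT4 fun z hz => ?_)
      (integral_add (((i13.add i14).add i23).add i24) (((i15.add i25).add i35).add i45))
    simp only [A]
    rw [show 3 * ε - 1 = 1 + (3 * ε - 2) by ring, Real.rpow_add (fiveU_pos hz), Real.rpow_one]
    nth_rw 1 [fiveU]
    ring
  have expandC : ∫ z in fiveT4, fiveU z ^ (3 * ε - 1) * fiveC z ^ (-(1 + 2 * ε)) =
      (∫ z in fiveT4, (B (fun z => z.1 * z.2.1 * z.2.2.1) z +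
        B (fun z => z.1 * z.2.1 * z.2.2.2) z + B (fun z => z.1 * z.2.2.1 * z.2.2.2) z +
        B (fun z => z.2.1 * z.2.2.1 * z.2.2.2) z)) +
      ∫ z in fiveT4, (B (fun z => z.1 * z.2.1 * fiveZ5 z) z +
        B (fun z => z.1 * z.2.2.2 * fiveZ5 z) z + B (fun z => z.2.1 * z.2.2.1 * fiveZ5 z) z +
        B (fun z => z.2.2.1 * z.2.2.2 * fiveZ5 z) z) := by
    refine Eq.trans (setIntegral_congr_fun measurableSet_fiveT4 fun z hz => ?_)
      (integral_add (((i123.add i124).add i134).add i234) (((i125.add i145).add i235).add i345))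
    simp only [B]
    rw [show -(1 + 2 * ε) = 1 + -(2 + 2 * ε) by ring, Real.rpow_add (fiveC_pos hz),
      Real.rpow_one]
    nth_rw 1 [fiveC]
    ring
  have jA : IntegrableOn (fun z => A (fun z => z.1 * fiveZ5 z) z +
      A (fun z => z.2.1 * fiveZ5 z) z + A (fun z => z.2.2.1 * fiveZ5 z) z +
      A (fun z => z.2.2.2 * fiveZ5 z) z) fiveT4 := ((i15.add i25).add i35).add i45
  have jB : IntegrableOn (fun z => B (fun z => z.1 * z.2.1 * fiveZ5 z) z +
      B (fun z => z.1 * z.2.2.2 * fiveZ5 z) z + B (fun z => z.2.1 * z.2.2.1 * fiveZ5 z) z +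
      B (fun z => z.2.2.1 * z.2.2.2 * fiveZ5 z) z) fiveT4 := ((i125.add i145).add i235).add i345
  have ibp : (∫ z in fiveT4, fiveU z ^ (3 * ε - 1) * fiveC z ^ (-(1 + 2 * ε))) -
      (1 - 3 * ε) * (∫ z in fiveT4, (A (fun z => z.1 * fiveZ5 z) z +
        A (fun z => z.2.1 * fiveZ5 z) z + A (fun z => z.2.2.1 * fiveZ5 z) z +
        A (fun z => z.2.2.2 * fiveZ5 z) z)) -
      (1 + 2 * ε) * (∫ z in fiveT4, (B (fun z => z.1 * z.2.1 * fiveZ5 z) z +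
        B (fun z => z.1 * z.2.2.2 * fiveZ5 z) z + B (fun z => z.2.1 * z.2.2.1 * fiveZ5 z) z +
        B (fun z => z.2.2.1 * z.2.2.2 * fiveZ5 z) z)) = 0 := by
    have split := integral_sub (hf.sub (jA.const_mul (1 - 3 * ε))) (jB.const_mul (1 + 2 * ε))
    have split' := integral_sub hf (jA.const_mul (1 - 3 * ε))
    simp only [Pi.sub_apply, integral_const_mul] at split split'
    rw [← split', ← split, ← setIntegral_fiveZ5_ibp hε]
    refine integral_congr_ae (.of_forall fun z => ?_)
    simp only [A, B]
    ring
  rw [hAL, hAZ] at expandU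
  rw [hBL, hBZ] at expandC
  rw [hAZ, hBZ] at ibp
  refine ⟨hf, i23, i24, i35, i234, i124, i235, i345, ?_⟩
  change (∫ z in fiveT4, fiveU z ^ (3 * ε - 1) * fiveC z ^ (-(1 + 2 * ε))) -
    (1 - 3 * ε) * ((∫ z in fiveT4, A (fun z => z.2.1 * z.2.2.1) z) +
      (∫ z in fiveT4, A (fun z => z.2.1 * z.2.2.2) z) +
      ∫ z in fiveT4, A (fun z => z.2.2.1 * fiveZ5 z) z) =
    (1 + 2 * ε) * (2 * (∫ z in fiveT4, B (fun z => z.2.1 * z.2.2.1 * z.2.2.2) z) +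
      (∫ z in fiveT4, B (fun z => z.1 * z.2.1 * z.2.2.2) z) +
      (∫ z in fiveT4, B (fun z => z.2.1 * z.2.2.1 * fiveZ5 z) z) +
      ∫ z in fiveT4, B (fun z => z.2.2.1 * z.2.2.2 * fiveZ5 z) z)
  rw [s13, s14, s15, s25, s45] at expandU
  rw [s15, s25, s45, s125, s145] at ibp
  rw [s134, s123, s124, s125, s145] at expandC
  rw [s124]
  linear_combination (1 - 3 * ε) / 2 * expandU + 3 / 4 * (1 + 2 * ε) * expandC - 1 / 4 * ibp
end
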